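/- arXiv:1207.5168 — 9 statements merged into one kernel-verified Lean document; each statement's English description precedes it below -/
import Mathlib

section
/- Let A be an alphabet with A_max = max A and δ_A > 1/2. For x > 0 let F_A(x) denote the number of finite sequences of even positive length with all entries in A whose continuant is at most x. Then for every real x ≥ 4·A_max², one has x^{2δ_A}/(32·A_max⁴) ≤ F_A(x) − F_A(x/(4·A_max²)) ≤ F_A(x) ≤ 8·x^{2δ_A}. -/
/-- Continuant `⟨d₁,…,d_k⟩`: `⟨⟩ = 1`, `⟨d⟩ = d`,
`⟨d₁,…,d_k⟩ = ⟨d₁,…,d_{k−1}⟩·d_k + ⟨d₁,…,d_{k−2}⟩`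
(formulated via the equivalent left recursion). -/
def cont : List ℕ → ℕ
  | [] => 1
  | [d] => d
  | d :: e :: D => d * cont (e :: D) + cont D

/-- The Gauss map `y ↦ {1/y}`. -/
noncomputable def gaussMap (y : ℝ) : ℝ := Int.fract (1 / y)

/-- The set `E_A` of irrationals in `(0,1)` whose infinite continued fraction expansion
has all partial quotients in `A`. -/
def cfSet (A : Finset ℕ) : Set ℝ :=
  {x | x ∈ Set.Ioo (0:ℝ) 1 ∧ Irrational x ∧
    ∀ n : ℕ, ∃ a ∈ A, (a : ℤ) = ⌊1 / (gaussMap^[n] x)⌋}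

/-- `δ_A`, the Hausdorff dimension of `E_A`. -/
noncomputable def cfDim (A : Finset ℕ) : ℝ := (dimH (cfSet A)).toReal

/-- `F_A(x)`: the number of finite sequences of even positive length over `A`
with continuant at most `x`. -/
noncomputable def FA (A : Finset ℕ) (x : ℝ) : ℕ :=
  {L : List ℕ | L ≠ [] ∧ Even L.length ∧ (∀ d ∈ L, d ∈ A) ∧ (cont L : ℝ) ≤ x}.ncard

/-! ### Continuants -/

lemma cont_cons_cons (d e : ℕ) (D : List ℕ) :
    cont (d :: e :: D) = d * cont (e :: D) + cont D := rfl

lemma cont_pos : ∀ D : List ℕ, (∀ d ∈ D, 0 < d) → 0 < cont D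
  | [], _ => Nat.one_pos
  | [d], h => h d (by simp)
  | d :: e :: D, h => by
    rw [cont_cons_cons]
    have := cont_pos D fun a ha => h a (by simp [ha])
    omega

lemma mul_cont_le_cont_cons (d : ℕ) : ∀ D : List ℕ, d * cont D ≤ cont (d :: D)
  | [] => by simp [cont]
  | e :: D => by rw [cont_cons_cons]; omega

lemma cont_cons_le {d : ℕ} (hd : 0 < d) : ∀ D : List ℕ, (∀ a ∈ D, 0 < a) →
    cont (d :: D) ≤ 2 * d * cont D
  | [], _ => by simp only [cont]; omega
  | e :: D, h => by
    rw [cont_cons_cons]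
    have h1 : cont D ≤ e * cont D := Nat.le_mul_of_pos_left _ (h e (by simp))
    have h2 := mul_cont_le_cont_cons e D
    have h3 : cont (e :: D) ≤ d * cont (e :: D) := Nat.le_mul_of_pos_left _ hd
    linarith

lemma length_le_two_mul_cont : ∀ D : List ℕ, (∀ d ∈ D, 0 < d) → D.length ≤ 2 * cont D
  | [], _ => by simp
  | [d], h => by
    have : 0 < d := h d (by simp)
    simp only [List.length_singleton, cont]
    omega
  | d :: e :: D, h => by
    rw [cont_cons_cons]
    have h1 := length_le_two_mul_cont D fun a ha => h a (by simp [ha])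
    have h2 : 0 < d * cont (e :: D) :=
      Nat.mul_pos (h d (by simp)) (cont_pos _ fun a ha => h a (List.mem_cons_of_mem _ ha))
    simp only [List.length_cons]
    omega

lemma cont_mul_cont_le_cont_append (T : List ℕ) : ∀ D : List ℕ,
    cont D * cont T ≤ cont (D ++ T)
  | [] => by simp [cont]
  | [d] => by simpa [cont] using mul_cont_le_cont_cons d T
  | d :: e :: D => by
    have h1 := cont_mul_cont_le_cont_append T (e :: D)
    have h2 := cont_mul_cont_le_cont_append T D
    simp only [List.cons_append, cont_cons_cons] at h1 ⊢
    nlinarith [Nat.mul_le_mul_left d h1]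

lemma cont_append_le {T : List ℕ} (hT : ∀ d ∈ T, 0 < d) : ∀ D : List ℕ, (∀ d ∈ D, 0 < d) →
    cont (D ++ T) ≤ 2 * (cont D * cont T)
  | [], _ => by simp only [List.nil_append, cont]; omega
  | [d], h => by
    have := cont_cons_le (h d (by simp)) T hT
    simp only [List.cons_append, List.nil_append, cont]
    linarith
  | d :: e :: D, h => by
    have h1 := cont_append_le hT (e :: D) fun a ha => h a (List.mem_cons_of_mem _ ha)
    have h2 := cont_append_le hT D fun a ha => h a (by simp [ha])
    simp only [List.cons_append, cont_cons_cons] at h1 ⊢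
    nlinarith [Nat.mul_le_mul_left d h1]

lemma two_le_cont {D : List ℕ} (h : ∀ d ∈ D, 0 < d) (hne : D ≠ []) (heven : Even D.length) :
    2 ≤ cont D := by
  match D, h, hne, heven with
  | [d], _, _, heven => simp at heven
  | d :: e :: D, h, _, _ =>
    rw [cont_cons_cons]
    have h1 := cont_pos D fun a ha => h a (by simp [ha])
    have h2 : 0 < d * cont (e :: D) :=
      Nat.mul_pos (h d (by simp)) (cont_pos _ fun a ha => h a (List.mem_cons_of_mem _ ha))
    omega

/-! ### The inverse branches of iterates of the Gauss map -/

/-- The finite continued fraction `[0; d₁, …, d_k + y]` as a function of `y`. -/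
noncomputable def cfBranch (D : List ℕ) (y : ℝ) : ℝ := D.foldr (fun (d : ℕ) z => 1 / (d + z)) y

@[simp] lemma cfBranch_nil (y : ℝ) : cfBranch [] y = y := rfl

@[simp] lemma cfBranch_cons (d : ℕ) (D : List ℕ) (y : ℝ) :
    cfBranch (d :: D) y = 1 / (d + cfBranch D y) := rfl

lemma cfBranch_append (D T : List ℕ) (y : ℝ) :
    cfBranch (D ++ T) y = cfBranch D (cfBranch T y) := by
  simp only [cfBranch, List.foldr_append]

/-- The denominator of `cfBranch D y` as a linear fractional transformation. -/
noncomputable def cfDenom : List ℕ → ℝ → ℝ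
  | [], _ => 1
  | d :: D, y => (d + cfBranch D y) * cfDenom D y

lemma cfBranch_nonneg {y : ℝ} (hy : 0 ≤ y) : ∀ D : List ℕ, 0 ≤ cfBranch D y
  | [] => hy
  | d :: D => by
    have := cfBranch_nonneg hy D
    rw [cfBranch_cons]
    positivity

lemma cast_add_cfBranch_pos {d : ℕ} (hd : 0 < d) {y : ℝ} (hy : 0 ≤ y) (D : List ℕ) :
    0 < d + cfBranch D y :=
  add_pos_of_pos_of_nonneg (Nat.cast_pos.2 hd) (cfBranch_nonneg hy D)

lemma cfDenom_cons_cons {d e : ℕ} {D : List ℕ} (he : 0 < e) {y : ℝ} (hy : 0 ≤ y) :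
    cfDenom (d :: e :: D) y = d * cfDenom (e :: D) y + cfDenom D y := by
  have := (cast_add_cfBranch_pos he hy D).ne'
  simp only [cfDenom, cfBranch_cons]
  field_simp

lemma cont_le_cfDenom {y : ℝ} (hy : 0 ≤ y) : ∀ D : List ℕ, (∀ d ∈ D, 0 < d) →
    (cont D : ℝ) ≤ cfDenom D y
  | [], _ => by simp [cont, cfDenom]
  | [d], _ => by simp [cont, cfDenom, hy]
  | d :: e :: D, h => by
    rw [cfDenom_cons_cons (h e (by simp)) hy, cont_cons_cons]
    have h1 := cont_le_cfDenom hy (e :: D) fun a ha => h a (List.mem_cons_of_mem _ ha)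
    have h2 := cont_le_cfDenom hy D fun a ha => h a (by simp [ha])
    push_cast
    gcongr

lemma cfDenom_le_two_mul_cont {y : ℝ} (hy : 0 ≤ y) (hy1 : y ≤ 1) : ∀ D : List ℕ,
    (∀ d ∈ D, 0 < d) → cfDenom D y ≤ 2 * cont D
  | [], _ => by simp [cont, cfDenom]
  | [d], h => by
    have : (1 : ℝ) ≤ d := Nat.one_le_cast.2 (h d (by simp))
    simp only [cont, cfDenom, cfBranch_nil]
    linarith
  | d :: e :: D, h => by
    rw [cfDenom_cons_cons (h e (by simp)) hy, cont_cons_cons]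
    have h1 := cfDenom_le_two_mul_cont hy hy1 (e :: D) fun a ha => h a (List.mem_cons_of_mem _ ha)
    have h2 := cfDenom_le_two_mul_cont hy hy1 D fun a ha => h a (by simp [ha])
    have h3 := mul_le_mul_of_nonneg_left h1 (Nat.cast_nonneg (α := ℝ) d)
    push_cast
    linarith

lemma cfDenom_pos {D : List ℕ} (hD : ∀ d ∈ D, 0 < d) {y : ℝ} (hy : 0 ≤ y) : 0 < cfDenom D y :=
  (Nat.cast_pos.2 (cont_pos D hD)).trans_le (cont_le_cfDenom hy D hD)

lemma abs_cfBranch_sub {y z : ℝ} (hy : 0 ≤ y) (hz : 0 ≤ z) : ∀ D : List ℕ, (∀ d ∈ D, 0 < d) →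
    |cfBranch D y - cfBranch D z| = |y - z| / (cfDenom D y * cfDenom D z)
  | [], _ => by simp [cfDenom]
  | d :: D, h => by
    have hd := h d (by simp)
    have h1 := cast_add_cfBranch_pos hd hy D
    have h2 := cast_add_cfBranch_pos hd hz D
    rw [cfBranch_cons, cfBranch_cons, div_sub_div _ _ h1.ne' h2.ne', abs_div,
      abs_of_pos (mul_pos h1 h2), abs_sub_comm,
      show (d + cfBranch D y) * 1 - 1 * (d + cfBranch D z) = cfBranch D y - cfBranch D z by ring,
      abs_cfBranch_sub hy hz D fun a ha => h a (by simp [ha]), div_div]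
    simp only [cfDenom]
    ring_nf

lemma abs_cfBranch_sub_le {D : List ℕ} (hD : ∀ d ∈ D, 0 < d) {y z : ℝ} (hy : 0 ≤ y)
    (hz : 0 ≤ z) : |cfBranch D y - cfBranch D z| ≤ |y - z| / (cont D : ℝ) ^ 2 := by
  have hq : (0 : ℝ) < cont D := Nat.cast_pos.2 (cont_pos D hD)
  have h1 := cont_le_cfDenom hy D hD
  have h2 := cont_le_cfDenom hz D hD
  have hy' := cfDenom_pos hD hy
  rw [abs_cfBranch_sub hy hz D hD, sq]
  gcongr

lemma le_abs_cfBranch_sub {D : List ℕ} (hD : ∀ d ∈ D, 0 < d) {y z : ℝ} (hy : y ∈ Set.Icc 0 1)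
    (hz : z ∈ Set.Icc 0 1) :
    |y - z| / (2 * (cont D : ℝ)) ^ 2 ≤ |cfBranch D y - cfBranch D z| := by
  have hy' := cfDenom_pos hD hy.1
  have hz' := cfDenom_pos hD hz.1
  have h1 := cfDenom_le_two_mul_cont hy.1 hy.2 D hD
  have h2 := cfDenom_le_two_mul_cont hz.1 hz.2 D hD
  rw [abs_cfBranch_sub hy.1 hz.1 D hD, sq]
  gcongr

lemma one_div_add_mem_Ioo {d : ℕ} (hd : 0 < d) {y : ℝ} (hy : 0 < y) :
    1 / (d + y) ∈ Set.Ioo (0 : ℝ) 1 := by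
  have : (1 : ℝ) ≤ d := Nat.one_le_cast.2 hd
  exact ⟨by positivity, by rw [div_lt_one (by positivity)]; linarith⟩

lemma floor_one_div_one_div_add (d : ℕ) {y : ℝ} (hy : y ∈ Set.Ico (0 : ℝ) 1) :
    ⌊1 / (1 / ((d : ℝ) + y))⌋ = d := by
  rw [one_div_one_div, Int.floor_natCast_add, Int.floor_eq_zero_iff.2 hy, add_zero]

lemma gaussMap_one_div_add (d : ℕ) {y : ℝ} (hy : y ∈ Set.Ico (0 : ℝ) 1) :
    gaussMap (1 / ((d : ℝ) + y)) = y := by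
  rw [gaussMap, one_div_one_div, Int.fract_natCast_add, Int.fract_eq_self.2 hy]

lemma cfBranch_mem_Ioo {y : ℝ} (hy : y ∈ Set.Ioo (0 : ℝ) 1) : ∀ D : List ℕ, (∀ d ∈ D, 0 < d) →
    cfBranch D y ∈ Set.Ioo (0 : ℝ) 1
  | [], _ => hy
  | d :: D, h => one_div_add_mem_Ioo (h d (by simp))
      (cfBranch_mem_Ioo hy D fun a ha => h a (by simp [ha])).1

lemma prefix_or_prefix_of_cfBranch_eq {y z : ℝ} (hy : y ∈ Set.Ioo (0 : ℝ) 1)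
    (hz : z ∈ Set.Ioo (0 : ℝ) 1) : ∀ D T : List ℕ, (∀ d ∈ D, 0 < d) → (∀ d ∈ T, 0 < d) →
    cfBranch D y = cfBranch T z → D <+: T ∨ T <+: D
  | [], T, _, _, _ => Or.inl T.nil_prefix
  | D, [], _, _, _ => Or.inr D.nil_prefix
  | d :: D, t :: T, hD, hT, h => by
    have hD' : ∀ a ∈ D, 0 < a := fun a ha => hD a (by simp [ha])
    have hT' : ∀ a ∈ T, 0 < a := fun a ha => hT a (by simp [ha])
    have hu := Set.Ioo_subset_Ico_self (cfBranch_mem_Ioo hy D hD')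
    have hv := Set.Ioo_subset_Ico_self (cfBranch_mem_Ioo hz T hT')
    rw [cfBranch_cons, cfBranch_cons] at h
    have h1 : d = t := by
      have := floor_one_div_one_div_add d hu
      rw [h, floor_one_div_one_div_add t hv] at this
      exact_mod_cast this.symm
    have h2 := gaussMap_one_div_add d hu
    rw [h, gaussMap_one_div_add t hv] at h2
    subst h1
    simpa using prefix_or_prefix_of_cfBranch_eq hy hz D T hD' hT' h2.symm

/-! ### Invariance of `cfSet` -/

lemma exists_eq_one_div_add_of_mem_cfSet {A : Finset ℕ} {x : ℝ} (hx : x ∈ cfSet A) :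
    ∃ a ∈ A, ∃ y ∈ cfSet A, x = 1 / (a + y) := by
  obtain ⟨hx1, hirr, hdig⟩ := hx
  obtain ⟨a, ha, hfl⟩ := hdig 0
  rw [Function.iterate_zero, id] at hfl
  have hg : 1 / x = a + gaussMap x := by
    rw [gaussMap, ← Int.cast_natCast a, hfl, Int.floor_add_fract]
  have hirr' : Irrational (gaussMap x) := by
    have h1 : Irrational (1 / x) := by simpa using hirr.inv
    rw [hg] at h1
    simpa using h1
  refine ⟨a, ha, gaussMap x, ⟨⟨?_, Int.fract_lt_one _⟩, hirr', fun n => ?_⟩, ?_⟩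
  · exact lt_of_le_of_ne (Int.fract_nonneg _) fun h => hirr'.ne_zero h.symm
  · simpa only [Function.iterate_succ_apply] using hdig (n + 1)
  · rw [← hg, one_div_one_div]

lemma irrational_of_iterate_gaussMap_ne_zero {x : ℝ} (h0 : 0 < x)
    (h : ∀ n, gaussMap^[n] x ≠ 0) : Irrational x := by
  suffices ∀ n : ℕ, ∀ q : ℚ, 0 < q → q.num.toNat ≤ n → ∃ k, gaussMap^[k] (q : ℝ) = 0 by
    rintro ⟨q, rfl⟩
    obtain ⟨k, hk⟩ := this _ q (by exact_mod_cast h0) le_rfl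
    exact h k hk
  intro n
  induction n with
  | zero =>
    intro q hq hn
    have := Rat.num_pos.2 hq
    omega
  | succ n ih =>
    intro q hq hn
    have hgq : gaussMap (q : ℝ) = ((Int.fract q⁻¹ : ℚ) : ℝ) := by
      rw [gaussMap, Rat.cast_fract, Rat.cast_inv, one_div]
    rcases (Int.fract_nonneg q⁻¹).eq_or_lt with h0 | h0
    · exact ⟨1, by simp [hgq, ← h0]⟩
    · have := Rat.fract_inv_num_lt_num_of_pos hq
      obtain ⟨k, hk⟩ := ih _ h0 (by omega)
      exact ⟨k + 1, by rw [Function.iterate_succ_apply, hgq, hk]⟩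

lemma subset_cfSet_of_forall_exists {A : Finset ℕ} (hpos : ∀ a ∈ A, 0 < a) {S : Set ℝ}
    (h0 : ∀ x ∈ S, 0 < x) (h : ∀ x ∈ S, ∃ a ∈ A, ∃ y ∈ S, x = 1 / (a + y)) : S ⊆ cfSet A := by
  have hS : S ⊆ Set.Ioo 0 1 := by
    intro x hx
    obtain ⟨a, ha, y, hy, rfl⟩ := h x hx
    exact one_div_add_mem_Ioo (hpos a ha) (h0 y hy)
  have hg : ∀ x ∈ S, (∃ a ∈ A, (a : ℤ) = ⌊1 / x⌋) ∧ gaussMap x ∈ S := by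
    intro x hx
    obtain ⟨a, ha, y, hy, rfl⟩ := h x hx
    have hy1 := Set.Ioo_subset_Ico_self (hS hy)
    exact ⟨⟨a, ha, (floor_one_div_one_div_add a hy1).symm⟩, by rwa [gaussMap_one_div_add a hy1]⟩
  intro x hx
  have hit : ∀ n, gaussMap^[n] x ∈ S := by
    intro n
    induction n with
    | zero => exact hx
    | succ n ih => rw [Function.iterate_succ_apply']; exact (hg _ ih).2
  exact ⟨hS hx, irrational_of_iterate_gaussMap_ne_zero (h0 x hx) fun n => (h0 _ (hit n)).ne',
    fun n => (hg _ (hit n)).1⟩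

lemma subset_cfSet_of_forall_exists_cfBranch {A : Finset ℕ} (hpos : ∀ a ∈ A, 0 < a) {S : Set ℝ}
    (h0 : ∀ x ∈ S, 0 < x)
    (h : ∀ x ∈ S, ∃ D : List ℕ, D ≠ [] ∧ (∀ d ∈ D, d ∈ A) ∧ ∃ y ∈ S, x = cfBranch D y) :
    S ⊆ cfSet A := by
  set S' : Set ℝ := {x | ∃ D : List ℕ, (∀ d ∈ D, d ∈ A) ∧ ∃ y ∈ S, x = cfBranch D y}
  have hsub : S ⊆ S' := fun x hx => ⟨[], by simp, x, hx, rfl⟩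
  have h1 : ∀ d : ℕ, ∀ D : List ℕ, (∀ a ∈ d :: D, a ∈ A) → ∀ y ∈ S,
      ∃ a ∈ A, ∃ z ∈ S', cfBranch (d :: D) y = 1 / (a + z) := fun d D hD y hy =>
    ⟨d, hD d (by simp), cfBranch D y, ⟨D, fun a ha => hD a (by simp [ha]), y, hy, rfl⟩, rfl⟩
  refine hsub.trans (subset_cfSet_of_forall_exists hpos ?_ ?_)
  · rintro _ ⟨D, hD, y, hy, rfl⟩
    cases D with
    | nil => exact h0 y hy
    | cons d D =>
      have := cast_add_cfBranch_pos (hpos d (hD d (by simp))) (h0 y hy).le D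
      rw [cfBranch_cons]
      positivity
  · rintro _ ⟨D, hD, y, hy, rfl⟩
    cases D with
    | nil =>
      obtain ⟨D, hne, hDA, z, hz, rfl⟩ := h y hy
      obtain ⟨d, D, rfl⟩ := List.exists_cons_of_ne_nil hne
      exact h1 d D hDA z hz
    | cons d D => exact h1 d D hD y hy

/-! ### Dimension bounds for iterated function systems -/

section IteratedFunctionSystem

open Set Filter Metric MeasureTheory
open scoped NNReal ENNReal Topology

lemma dimH_le_of_forall_exists_eq {X ι : Type*} [MetricSpace X] [Fintype ι] {E : Set X}
    (hE : ediam E ≤ 1) (f : ι → X → X) {c : ℝ≥0} (hc : c < 1)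
    (hf : ∀ i, LipschitzOnWith c (f i) E) (hcov : ∀ x ∈ E, ∃ i, ∃ y ∈ E, x = f i y)
    {s : ℝ≥0} (hs : (Fintype.card ι : ℝ≥0) * c ^ (s : ℝ) ≤ 1) : dimH E ≤ s := by
  borelize X
  have key : ∀ n : ℕ, ∃ t : (Fin n → ι) → Set X,
      E ⊆ ⋃ w, t w ∧ ∀ w, t w ⊆ E ∧ ediam (t w) ≤ (c : ℝ≥0∞) ^ n := by
    intro n
    induction n with
    | zero => exact ⟨fun _ => E, subset_iUnion_of_subset Fin.elim0 subset_rfl, fun _ =>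
        ⟨subset_rfl, by simpa using hE⟩⟩
    | succ n ih =>
      obtain ⟨t, hcovt, ht⟩ := ih
      refine ⟨fun w => f (w 0) '' t (Fin.tail w) ∩ E, fun x hx => ?_, fun w =>
        ⟨inter_subset_right, ?_⟩⟩
      · obtain ⟨i, y, hy, rfl⟩ := hcov x hx
        obtain ⟨w, hw⟩ := mem_iUnion.1 (hcovt hy)
        exact mem_iUnion.2 ⟨Fin.cons i w, ⟨y, by simpa using hw, by simp⟩, hx⟩
      · calc ediam (f (w 0) '' t (Fin.tail w) ∩ E)
            ≤ ediam (f (w 0) '' t (Fin.tail w)) := ediam_mono inter_subset_left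
          _ ≤ c * ediam (t (Fin.tail w)) := 
            ediam_image_le_iff.2 fun x hx y hy =>
              (hf _ ((ht _).1 hx) ((ht _).1 hy)).trans (by gcongr; exact edist_le_ediam_of_mem hx hy)
          _ ≤ c * (c : ℝ≥0∞) ^ n := by gcongr; exact (ht _).2
          _ = (c : ℝ≥0∞) ^ (n + 1) := (pow_succ' _ _).symm
  choose t hcovt ht using key
  refine dimH_le_of_hausdorffMeasure_ne_top (ne_top_of_le_ne_top ENNReal.one_ne_top ?_)
  have htend : Tendsto (fun n : ℕ => (c : ℝ≥0∞) ^ n) atTop (𝓝 0) :=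
    ENNReal.tendsto_pow_atTop_nhds_zero_of_lt_one (by exact_mod_cast hc)
  refine (Measure.hausdorffMeasure_le_liminf_sum (s : ℝ) E _ htend t
    (Eventually.of_forall fun n w => (ht n w).2) (Eventually.of_forall hcovt)).trans ?_
  refine liminf_le_of_frequently_le' (Frequently.of_forall fun n => ?_)
  calc ∑ w, ediam (t n w) ^ (s : ℝ)
      ≤ ∑ _w : Fin n → ι, ((c : ℝ≥0∞) ^ (s : ℝ)) ^ n := by
        refine Finset.sum_le_sum fun w _ => ?_
        rw [← ENNReal.rpow_natCast, ← ENNReal.rpow_mul, mul_comm, ENNReal.rpow_mul,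
          ENNReal.rpow_natCast]
        exact ENNReal.rpow_le_rpow (ht n w).2 s.coe_nonneg
    _ = ((Fintype.card ι : ℝ≥0∞) * (c : ℝ≥0∞) ^ (s : ℝ)) ^ n := by
        simp [mul_pow]
    _ ≤ 1 := by
        refine pow_le_one₀ zero_le ?_
        rw [← ENNReal.coe_rpow_of_nonneg _ s.coe_nonneg]
        exact_mod_cast hs

/-- The `n`-th level cylinder with address `ω` of an iterated function system on `K`. -/
def ifsCylinder {X ι : Type*} (f : ι → X → X) (K : Set X) : ℕ → (ℕ → ι) → Set X
  | 0, _ => K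
  | n + 1, ω => f (ω 0) '' ifsCylinder f K n fun k => ω (k + 1)

/-- The limit set of an iterated function system on `K`. -/
def ifsLimitSet {X ι : Type*} (f : ι → X → X) (K : Set X) : Set X :=
  {x | ∃ ω : ℕ → ι, ∀ n, x ∈ ifsCylinder f K n ω}

section Cylinder

variable {X ι : Type*} {f : ι → X → X} {K : Set X}

lemma ifsCylinder_subset (hmaps : ∀ i, MapsTo (f i) K K) :
    ∀ (n : ℕ) (ω : ℕ → ι), ifsCylinder f K n ω ⊆ K
  | 0, _ => subset_rfl
  | n + 1, ω => (image_mono (ifsCylinder_subset hmaps n _)).trans (hmaps (ω 0)).image_subset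

lemma ifsCylinder_succ_subset (hmaps : ∀ i, MapsTo (f i) K K) :
    ∀ (n : ℕ) (ω : ℕ → ι), ifsCylinder f K (n + 1) ω ⊆ ifsCylinder f K n ω
  | 0, ω => (hmaps (ω 0)).image_subset
  | n + 1, _ => image_mono (ifsCylinder_succ_subset hmaps n _)

lemma ifsCylinder_nonempty (hK : K.Nonempty) :
    ∀ (n : ℕ) (ω : ℕ → ι), (ifsCylinder f K n ω).Nonempty
  | 0, _ => hK
  | n + 1, _ => (ifsCylinder_nonempty hK n _).image _

lemma isCompact_ifsCylinder [TopologicalSpace X] (hK : IsCompact K)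
    (hmaps : ∀ i, MapsTo (f i) K K) (hcont : ∀ i, ContinuousOn (f i) K) :
    ∀ (n : ℕ) (ω : ℕ → ι), IsCompact (ifsCylinder f K n ω)
  | 0, _ => hK
  | n + 1, ω => (isCompact_ifsCylinder hK hmaps hcont n _).image_of_continuousOn
      ((hcont (ω 0)).mono (ifsCylinder_subset hmaps n _))

lemma exists_forall_mem_ifsCylinder [TopologicalSpace X] [T2Space X] (hK : IsCompact K)
    (hne : K.Nonempty) (hmaps : ∀ i, MapsTo (f i) K K) (hcont : ∀ i, ContinuousOn (f i) K)
    (ω : ℕ → ι) : ∃ x, ∀ n, x ∈ ifsCylinder f K n ω := by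
  have := IsCompact.nonempty_iInter_of_sequence_nonempty_isCompact_isClosed
    (fun n => ifsCylinder f K n ω) (fun n => ifsCylinder_succ_subset hmaps n ω)
    (fun n => ifsCylinder_nonempty hne n ω) (isCompact_ifsCylinder hK hmaps hcont 0 ω)
    (fun n => (isCompact_ifsCylinder hK hmaps hcont n ω).isClosed)
  simpa [Set.Nonempty] using this

lemma ifsLimitSet_subset : ifsLimitSet f K ⊆ K := fun _ ⟨_, h⟩ => h 0

lemma exists_eq_of_mem_ifsLimitSet (hmaps : ∀ i, MapsTo (f i) K K)
    (hinj : ∀ i, InjOn (f i) K) {x : X} (hx : x ∈ ifsLimitSet f K) :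
    ∃ i, ∃ y ∈ ifsLimitSet f K, x = f i y := by
  obtain ⟨ω, hω⟩ := hx
  obtain ⟨y, hy, rfl⟩ := hω 1
  refine ⟨ω 0, y, ⟨fun k => ω (k + 1), fun n => ?_⟩, rfl⟩
  obtain ⟨z, hz, hzy⟩ := hω (n + 1)
  rwa [← hinj _ (ifsCylinder_subset hmaps n _ hz) hy hzy]

lemma mul_pow_le_dist_of_mem_ifsCylinder [PseudoMetricSpace X] (hmaps : ∀ i, MapsTo (f i) K K)
    {r c : ℝ} (hr : 0 ≤ r) (hexp : ∀ i, ∀ x ∈ K, ∀ y ∈ K, r * dist x y ≤ dist (f i x) (f i y))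
    (hsep : ∀ i j, i ≠ j → ∀ x ∈ f i '' K, ∀ y ∈ f j '' K, c ≤ dist x y) :
    ∀ (n : ℕ) (ω η : ℕ → ι) (x y : X), x ∈ ifsCylinder f K (n + 1) ω →
      y ∈ ifsCylinder f K (n + 1) η → (∀ k < n, ω k = η k) → ω n ≠ η n →
      r ^ n * c ≤ dist x y
  | 0, ω, η, x, y, hx, hy, _, hne => by simpa using hsep _ _ hne x hx y hy
  | n + 1, ω, η, x, y, hx, hy, heq, hne => by
    obtain ⟨x, hx, rfl⟩ := hx
    obtain ⟨y, hy, rfl⟩ := hy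
    have h1 := mul_pow_le_dist_of_mem_ifsCylinder hmaps hr hexp hsep n _ _ x y hx hy
      (fun k hk => heq (k + 1) (by omega)) hne
    have h2 := hexp (ω 0) x (ifsCylinder_subset hmaps _ _ hx) y (ifsCylinder_subset hmaps _ _ hy)
    rw [← heq 0 (by omega)]
    calc r ^ (n + 1) * c = r * (r ^ n * c) := by ring
      _ ≤ r * dist x y := by gcongr
      _ ≤ _ := h2

lemma exists_separation [MetricSpace X] [Finite ι] (hK : IsCompact K)
    (hcont : ∀ i, ContinuousOn (f i) K)
    (hdisj : ∀ i j, i ≠ j → Disjoint (f i '' K) (f j '' K)) :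
    ∃ c > 0, ∀ i j, i ≠ j → ∀ x ∈ f i '' K, ∀ y ∈ f j '' K, c ≤ dist x y := by
  have h : ∀ p : ι × ι, ∃ c : ℝ, 0 < c ∧
      (p.1 ≠ p.2 → ∀ x ∈ f p.1 '' K, ∀ y ∈ f p.2 '' K, c ≤ dist x y) := by
    rintro ⟨i, j⟩
    by_cases hij : i = j
    · exact ⟨1, one_pos, fun h => absurd hij h⟩
    · obtain ⟨c, hc, h⟩ := exists_pos_forall_lt_edist (hK.image_of_continuousOn (hcont i))
        (hK.image_of_continuousOn (hcont j)).isClosed (hdisj i j hij)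
      refine ⟨c, hc, fun _ x hx y hy => ?_⟩
      have := (h x hx y hy).le
      rw [edist_nndist] at this
      exact_mod_cast this
  choose c hc h using h
  obtain ⟨ε, hε, hle⟩ : ∃ ε > 0, ∀ p, ε ≤ c p := by
    cases isEmpty_or_nonempty (ι × ι) with
    | inl hem => exact ⟨1, one_pos, fun p => hem.elim p⟩
    | inr hne =>
      obtain ⟨p, hp⟩ := Finite.exists_min c
      exact ⟨c p, hc p, hp⟩
  exact ⟨ε, hε, fun i j hij x hx y hy => (hle (i, j)).trans (h (i, j) hij x hx y hy)⟩

end Cylinder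

lemma le_dimH_ifsLimitSet {X : Type*} [MetricSpace X] {M : ℕ} (hM : 1 < M) {f : Fin M → X → X}
    {K : Set X} (hK : IsCompact K) (hne : K.Nonempty) (hmaps : ∀ i, MapsTo (f i) K K)
    (hcont : ∀ i, ContinuousOn (f i) K)
    (hdisj : ∀ i j, i ≠ j → Disjoint (f i '' K) (f j '' K)) {r : ℝ} (hr : 0 < r)
    (hexp : ∀ i, ∀ x ∈ K, ∀ y ∈ K, r * dist x y ≤ dist (f i x) (f i y))
    {s : ℝ≥0} (hs : 0 < s) (hrs : (M : ℝ)⁻¹ ≤ r ^ (s : ℝ)) : s ≤ dimH (ifsLimitSet f K) := by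
  obtain ⟨c, hc, hsep⟩ := exists_separation hK hcont hdisj
  have hcode : ∀ x : X, ∃ ω : ℕ → Fin M, x ∈ ifsLimitSet f K → ∀ n, x ∈ ifsCylinder f K n ω := by
    intro x
    by_cases hx : x ∈ ifsLimitSet f K
    · exact ⟨hx.choose, fun _ => hx.choose_spec⟩
    · exact ⟨fun _ => ⟨0, by omega⟩, fun h => absurd h hx⟩
  choose code hcode using hcode
  have hdiff : ∀ (ω η : ℕ → Fin M) (x y : X), (∀ n, x ∈ ifsCylinder f K n ω) →
      (∀ n, y ∈ ifsCylinder f K n η) → ω ≠ η →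
      ∃ n, (∀ k < n, ω k = η k) ∧ r ^ n * c ≤ dist x y := by
    intro ω η x y hx hy hωη
    have hex : ∃ n, ω n ≠ η n := Function.ne_iff.1 hωη
    classical
    have hlt : ∀ k < Nat.find hex, ω k = η k := fun k hk => not_not.1 (Nat.find_min hex hk)
    exact ⟨Nat.find hex, hlt, mul_pow_le_dist_of_mem_ifsCylinder hmaps hr.le hexp hsep _ ω η x y
      (hx _) (hy _) hlt (Nat.find_spec hex)⟩
  set g : X → ℝ := fun x => Real.ofDigits (code x) with hg
  have hsurj : Icc (0 : ℝ) 1 ⊆ g '' ifsLimitSet f K := by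
    intro u hu
    obtain ⟨ω, -, rfl⟩ := Real.ofDigits_SurjOn hM hu
    obtain ⟨x, hx⟩ := exists_forall_mem_ifsCylinder hK hne hmaps hcont ω
    refine ⟨x, ⟨ω, hx⟩, ?_⟩
    have : code x = ω := by
      by_contra hcon
      obtain ⟨n, -, hn⟩ := hdiff _ _ x x (hcode x ⟨ω, hx⟩) hx hcon
      rw [dist_self] at hn
      exact absurd hn (not_le.2 (by positivity))
    rw [hg, ← this]
  have hdist : ∀ x ∈ ifsLimitSet f K, ∀ y ∈ ifsLimitSet f K,
      dist (g x) (g y) ≤ c⁻¹ ^ (s : ℝ) * dist x y ^ (s : ℝ) := by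
    intro x hx y hy
    by_cases hxy : code x = code y
    · simp only [hg, hxy, dist_self]
      positivity
    · obtain ⟨n, hlt, hn⟩ := hdiff _ _ x y (hcode x hx) (hcode y hy) hxy
      have h1 : r ^ n ≤ c⁻¹ * dist x y := by
        rw [inv_mul_eq_div, le_div_iff₀ hc]
        exact hn
      calc dist (g x) (g y) ≤ ((M : ℝ) ^ n)⁻¹ := Real.abs_ofDigits_sub_ofDigits_le hlt
        _ = (M : ℝ)⁻¹ ^ n := (inv_pow _ _).symm
        _ ≤ (r ^ (s : ℝ)) ^ n := by gcongr
        _ = (r ^ n) ^ (s : ℝ) := by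
          rw [← Real.rpow_natCast, ← Real.rpow_mul hr.le, mul_comm, Real.rpow_mul hr.le,
            Real.rpow_natCast]
        _ ≤ (c⁻¹ * dist x y) ^ (s : ℝ) := by gcongr
        _ = _ := Real.mul_rpow (by positivity) dist_nonneg
  have hhol : HolderOnWith (c⁻¹ ^ (s : ℝ)).toNNReal s g (ifsLimitSet f K) := by
    intro x hx y hy
    change _ ≤ ENNReal.ofReal (c⁻¹ ^ (s : ℝ)) * _
    rw [edist_dist, edist_dist, ENNReal.ofReal_rpow_of_nonneg dist_nonneg s.coe_nonneg,
      ← ENNReal.ofReal_mul (by positivity)]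
    exact ENNReal.ofReal_le_ofReal (hdist x hx y hy)
  have h1 : (1 : ℝ≥0∞) ≤ dimH (ifsLimitSet f K) / s := by
    calc (1 : ℝ≥0∞) = dimH (Icc (0 : ℝ) 1) := by
          rw [Real.dimH_of_nonempty_interior (by simp), Module.finrank_self, Nat.cast_one]
      _ ≤ dimH (g '' ifsLimitSet f K) := dimH_mono hsurj
      _ ≤ _ := hhol.dimH_image_le hs
  simpa using ENNReal.mul_le_of_le_div h1

end IteratedFunctionSystem

/-! ### Counting words by continuant -/

/-- The words of even positive length over `A` with continuant at most `x`. -/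
def evenWords (A : Finset ℕ) (x : ℝ) : Set (List ℕ) :=
  {L : List ℕ | L ≠ [] ∧ Even L.length ∧ (∀ d ∈ L, d ∈ A) ∧ (cont L : ℝ) ≤ x}

section Counting

open Set Filter Metric
open scoped NNReal ENNReal Topology

variable {A : Finset ℕ}

lemma evenWords_mono {x y : ℝ} (h : x ≤ y) : evenWords A x ⊆ evenWords A y :=
  fun _ ⟨h1, h2, h3, h4⟩ => ⟨h1, h2, h3, h4.trans h⟩

lemma mem_evenWords_sdiff {x y : ℝ} {D : List ℕ} : D ∈ evenWords A x \ evenWords A y ↔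
    D ≠ [] ∧ Even D.length ∧ (∀ d ∈ D, d ∈ A) ∧ y < cont D ∧ cont D ≤ x := by
  simp only [evenWords, Set.mem_sdiff, mem_ofPred_eq, not_and, not_le]
  tauto

lemma finite_evenWords (hpos : ∀ a ∈ A, 0 < a) (x : ℝ) : (evenWords A x).Finite := by
  refine ((List.finite_length_le A (2 * ⌊x⌋₊)).image (List.map Subtype.val)).subset ?_
  rintro L ⟨-, -, hA, hx⟩
  lift L to List A using hA
  refine ⟨L, ?_, rfl⟩
  have h1 := length_le_two_mul_cont (L.map Subtype.val) fun d hd => hpos d (by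
    obtain ⟨a, -, rfl⟩ := List.mem_map.1 hd
    exact a.2)
  have h2 := Nat.le_floor hx
  rw [List.length_map] at h1
  change L.length ≤ _
  omega

lemma FA_eq_add_ncard_sdiff (hpos : ∀ a ∈ A, 0 < a) {x y : ℝ} (h : y ≤ x) :
    FA A x = FA A y + (evenWords A x \ evenWords A y).ncard := by
  change (evenWords A x).ncard = (evenWords A y).ncard + _
  rw [add_comm, ncard_sdiff_add_ncard_of_subset (evenWords_mono h) (finite_evenWords hpos x)]

lemma FA_eq_zero_of_lt_two (hpos : ∀ a ∈ A, 0 < a) {x : ℝ} (hx : x < 2) : FA A x = 0 := by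
  change (evenWords A x).ncard = 0
  suffices evenWords A x = ∅ by rw [this, ncard_empty]
  refine eq_empty_of_forall_notMem fun D ⟨hne, heven, hA, hle⟩ => ?_
  have : (2 : ℝ) ≤ cont D := mod_cast two_le_cont (fun d hd => hpos d (hA d hd)) hne heven
  linarith

lemma dimH_cfSet_le_one (A : Finset ℕ) : dimH (cfSet A) ≤ 1 :=
  (dimH_mono (subset_univ _)).trans_eq Real.dimH_univ

lemma dimH_cfSet_ne_top (A : Finset ℕ) : dimH (cfSet A) ≠ ∞ :=
  ne_top_of_le_ne_top ENNReal.one_ne_top (dimH_cfSet_le_one A)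

lemma cfDim_le_one (A : Finset ℕ) : cfDim A ≤ 1 := by
  simpa [cfDim] using ENNReal.toReal_mono ENNReal.one_ne_top (dimH_cfSet_le_one A)

lemma ediam_cfSet_le_one (A : Finset ℕ) : ediam (cfSet A) ≤ 1 := by
  calc ediam (cfSet A) ≤ ediam (Icc (0 : ℝ) 1) :=
        ediam_mono fun x hx => Ioo_subset_Icc_self hx.1
    _ = 1 := by simp

lemma lipschitzOnWith_cfBranch {D : List ℕ} (hD : ∀ d ∈ D, 0 < d) :
    LipschitzOnWith ((cont D : ℝ≥0) ^ 2)⁻¹ (cfBranch D) (Ici 0) :=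
  LipschitzOnWith.of_dist_le_mul fun y hy z hz => by
    simpa [Real.dist_eq, div_eq_inv_mul] using abs_cfBranch_sub_le hD hy hz

lemma exists_even_word_eq_cfBranch (hpos : ∀ a ∈ A, 0 < a) {N : ℕ} (hN : ∀ a ∈ A, a ≤ N)
    {y : ℝ} (hy : 1 ≤ y) {x : ℝ} (hx : x ∈ cfSet A) :
    ∃ D ∈ evenWords A (4 * (N : ℝ) ^ 2 * y) \ evenWords A y, ∃ z ∈ cfSet A,
      x = cfBranch D z := by
  by_contra! hcon
  have key : ∀ k : ℕ, ∃ D : List ℕ, D.length = 2 * k ∧ (∀ d ∈ D, d ∈ A) ∧ (cont D : ℝ) ≤ y ∧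
      ∃ z ∈ cfSet A, x = cfBranch D z := by
    intro k
    induction k with
    | zero => exact ⟨[], rfl, by simp, by simpa [cont] using hy, x, hx, rfl⟩
    | succ k ih =>
      obtain ⟨D, hlen, hDA, hle, z, hz, hxz⟩ := ih
      obtain ⟨a, ha, z', hz', rfl⟩ := exists_eq_one_div_add_of_mem_cfSet hz
      obtain ⟨b, hb, w, hw, rfl⟩ := exists_eq_one_div_add_of_mem_cfSet hz'
      have hxw : x = cfBranch (D ++ [a, b]) w := by rw [hxz, cfBranch_append]; rfl
      have hlen' : (D ++ [a, b]).length = 2 * (k + 1) := by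
        rw [List.length_append, hlen]; rfl
      have hab : ∀ d ∈ [a, b], d ∈ A := by simp [ha, hb]
      have hDA' : ∀ d ∈ D ++ [a, b], d ∈ A := fun d hd =>
        (List.mem_append.1 hd).elim (hDA d) (hab d)
      refine ⟨D ++ [a, b], hlen', hDA', not_lt.1 fun hlt => ?_, w, hw, hxw⟩
      refine hcon _ (mem_evenWords_sdiff.2
        ⟨by simp, hlen' ▸ even_two_mul _, hDA', hlt, ?_⟩) w hw hxw
      have h1 := cont_append_le (fun d hd => hpos d (hab d hd)) D fun d hd => hpos d (hDA d hd)
      have h2 : cont [a, b] ≤ 2 * N ^ 2 := by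
        have : a * b ≤ N * N := Nat.mul_le_mul (hN a ha) (hN b hb)
        have := Nat.mul_pos (hpos a ha) (hpos b hb)
        simp only [cont]
        nlinarith
      calc (cont (D ++ [a, b]) : ℝ) ≤ 2 * (cont D * cont [a, b]) := mod_cast h1
        _ ≤ 2 * (y * (2 * (N : ℝ) ^ 2)) := by
          gcongr
          exact_mod_cast h2
        _ = _ := by ring
  obtain ⟨D, hlen, hDA, hle, -⟩ := key (⌊y⌋₊ + 1)
  have h1 := length_le_two_mul_cont D fun d hd => hpos d (hDA d hd)
  have h2 := Nat.le_floor hle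
  omega

lemma rpow_le_ncard_evenWords_sdiff (hpos : ∀ a ∈ A, 0 < a) {N : ℕ} (hN : ∀ a ∈ A, a ≤ N)
    (hδ : 0 < cfDim A) {y : ℝ} (hy : 1 ≤ y) :
    y ^ (2 * cfDim A) ≤ (evenWords A (4 * (N : ℝ) ^ 2 * y) \ evenWords A y).ncard := by
  set Z := evenWords A (4 * (N : ℝ) ^ 2 * y) \ evenWords A y
  have hy0 : 0 < y := by linarith
  by_contra! hlt
  have hcont : Continuous fun s : ℝ => y ^ (2 * s) :=
    continuous_const.rpow (by fun_prop) fun _ => Or.inl hy0.ne'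
  obtain ⟨s, hs, hs0, hsδ⟩ := (((hcont.tendsto _).eventually_const_lt hlt).filter_mono
    (nhdsWithin_le_nhds (s := Iio (cfDim A))) |>.and (Ioo_mem_nhdsLT hδ)).exists
  have hfin : Z.Finite := (finite_evenWords hpos _).sdiff
  have := hfin.fintype
  lift s to ℝ≥0 using hs0.le
  set m : ℝ≥0 := max y.toNNReal 2
  have hmpos : 0 < m := lt_max_of_lt_right two_pos
  have hDpos : ∀ D : Z, ∀ d ∈ D.1, 0 < d := fun D d hd =>
    hpos d ((mem_evenWords_sdiff.1 D.2).2.2.1 d hd)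
  have hmD : ∀ D : Z, m ≤ cont D.1 := by
    intro D
    obtain ⟨hne, heven, -, hlt, -⟩ := mem_evenWords_sdiff.1 D.2
    refine max_le (Real.toNNReal_le_iff_le_coe.2 (by simpa using hlt.le)) ?_
    exact_mod_cast two_le_cont (hDpos D) hne heven
  have hdim : dimH (cfSet A) ≤ s := by
    refine dimH_le_of_forall_exists_eq (ediam_cfSet_le_one A) (fun D : Z => cfBranch D.1)
      (c := (m ^ 2)⁻¹) ?_ (fun D => ?_) (fun x hx => ?_) ?_
    · have : (2 : ℝ≥0) ≤ m := le_max_right _ _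
      exact inv_lt_one_of_one_lt₀ (one_lt_pow₀ (one_lt_two.trans_le this) two_ne_zero)
    · refine ((lipschitzOnWith_cfBranch (hDpos D)).mono fun x hx => hx.1.1.le).weaken ?_
      have := hmD D
      gcongr
    · obtain ⟨D, hD, z, hz, rfl⟩ := exists_even_word_eq_cfBranch hpos hN hy hx
      exact ⟨⟨D, hD⟩, z, hz, rfl⟩
    · rw [NNReal.inv_rpow, ← div_eq_mul_inv]
      refine div_le_one_of_le₀ ?_ zero_le
      rw [← NNReal.coe_le_coe, ← Nat.card_eq_fintype_card, Nat.card_coe_set_eq]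
      push_cast
      rw [← Real.rpow_natCast, ← Real.rpow_mul m.coe_nonneg]
      refine hs.le.trans (Real.rpow_le_rpow hy0.le ?_ (by positivity))
      exact (Real.le_coe_toNNReal y).trans (NNReal.coe_le_coe.2 (le_max_left _ _))
  exact hsδ.not_ge (ENNReal.toReal_le_coe_of_le_coe hdim)

lemma mapsTo_cfBranch_Icc {N : ℕ} {D : List ℕ} (hD : ∀ d ∈ D, 0 < d) (hN : ∀ d ∈ D, d ≤ N) :
    MapsTo (cfBranch D) (Icc (1 / ((N : ℝ) + 1)) ((N + 1) / (N + 2)))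
      (Icc (1 / ((N : ℝ) + 1)) ((N + 1) / (N + 2))) := by
  intro y hy
  induction D with
  | nil => exact hy
  | cons d D ih =>
    obtain ⟨h1, h2⟩ := ih (fun a ha => hD a (by simp [ha])) fun a ha => hN a (by simp [ha])
    have hd : (1 : ℝ) ≤ d := Nat.one_le_cast.2 (hD d (by simp))
    have hd' : (d : ℝ) ≤ N := Nat.cast_le.2 (hN d (by simp))
    have h0 : 0 < cfBranch D y := lt_of_lt_of_le (by positivity) h1
    have h3 : ((N : ℝ) + 1) / (N + 2) ≤ 1 := div_le_one_of_le₀ (by linarith) (by positivity)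
    rw [cfBranch_cons]
    constructor
    · gcongr
      linarith
    · calc 1 / (d + cfBranch D y) ≤ 1 / (1 + 1 / ((N : ℝ) + 1)) := by gcongr
        _ = (N + 1) / (N + 2) := by field_simp; ring

lemma Icc_subset_Ioo_zero_one (N : ℕ) :
    Icc (1 / ((N : ℝ) + 1)) ((N + 1) / (N + 2)) ⊆ Ioo 0 1 := by
  rintro y ⟨h1, h2⟩
  refine ⟨lt_of_lt_of_le (by positivity) h1, h2.trans_lt ?_⟩
  rw [div_lt_one (by positivity)]
  linarith

lemma eq_of_isPrefix_of_mem_evenWords_sdiff (hpos : ∀ a ∈ A, 0 < a) {x : ℝ} {D T : List ℕ}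
    (hD : D ∈ evenWords A x \ evenWords A (x / 2)) (hT : T ∈ evenWords A x \ evenWords A (x / 2))
    (h : D <+: T) : D = T := by
  obtain ⟨U, rfl⟩ := h
  obtain ⟨-, hDe, -, hD1, -⟩ := mem_evenWords_sdiff.1 hD
  obtain ⟨-, hTe, hTA, -, hT2⟩ := mem_evenWords_sdiff.1 hT
  rcases eq_or_ne U [] with rfl | hU
  · simp
  have hUe : Even U.length := by
    rw [List.length_append, Nat.even_add] at hTe
    exact hTe.1 hDe
  have h1 : 2 ≤ cont U := two_le_cont (fun d hd => hpos d (hTA d (by simp [hd]))) hU hUe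
  have h2 : cont D * 2 ≤ cont (D ++ U) :=
    (Nat.mul_le_mul_left _ h1).trans (cont_mul_cont_le_cont_append U D)
  have h3 : (cont D : ℝ) * 2 ≤ cont (D ++ U) := mod_cast h2
  linarith

lemma ncard_evenWords_sdiff_half_le (hpos : ∀ a ∈ A, 0 < a) {x : ℝ} (hx : 0 < x) :
    ((evenWords A x \ evenWords A (x / 2)).ncard : ℝ) ≤ (2 * x) ^ (2 * cfDim A) := by
  set Z := evenWords A x \ evenWords A (x / 2)
  by_contra! hlt
  have hcont : Continuous fun s : ℝ => (2 * x) ^ (2 * s) :=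
    continuous_const.rpow (by fun_prop) fun _ => Or.inl (by positivity)
  obtain ⟨s, hs, hsδ⟩ := (((hcont.tendsto _).eventually_lt_const hlt).filter_mono
    (nhdsWithin_le_nhds (s := Ioi (cfDim A))) |>.and self_mem_nhdsWithin).exists
  have hs0 : 0 < s := ENNReal.toReal_nonneg.trans_lt hsδ
  lift s to ℝ≥0 using hs0.le
  have hfin : Z.Finite := (finite_evenWords hpos _).sdiff
  have : Finite Z := hfin
  have hDpos : ∀ D ∈ Z, ∀ d ∈ D, 0 < d := fun D hD d hd =>
    hpos d ((mem_evenWords_sdiff.1 hD).2.2.1 d hd)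
  have hx2 : 2 ≤ x := by
    have hne : Z.ncard ≠ 0 := by
      intro h0
      rw [h0, Nat.cast_zero] at hlt
      exact hlt.not_ge (by positivity)
    obtain ⟨D, hD⟩ := nonempty_of_ncard_ne_zero hne
    obtain ⟨hne, heven, -, -, hle⟩ := mem_evenWords_sdiff.1 hD
    have : (2 : ℝ) ≤ cont D := mod_cast two_le_cont (hDpos D hD) hne heven
    linarith
  have hM : 1 < Nat.card Z := by
    rw [Nat.card_coe_set_eq]
    have : (1 : ℝ) < Z.ncard :=
      (Real.one_le_rpow (by linarith) (by positivity)).trans_lt hs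
    exact_mod_cast this
  set e := Finite.equivFin Z
  set f : Fin (Nat.card Z) → ℝ → ℝ := fun i => cfBranch (e.symm i).1
  set N := A.sup id + 1
  set K := Icc (1 / ((N : ℝ) + 1)) ((N + 1) / (N + 2))
  have hK01 : K ⊆ Ioo 0 1 := Icc_subset_Ioo_zero_one N
  have hKne : K.Nonempty := by
    refine nonempty_Icc.2 ?_
    rw [div_le_div_iff₀ (by positivity) (by positivity)]
    have : (1 : ℝ) ≤ N := Nat.one_le_cast.2 (Nat.le_add_left 1 _)
    nlinarith
  have hpos' : ∀ i, ∀ d ∈ (e.symm i).1, 0 < d := fun i => hDpos _ (e.symm i).2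
  have hmaps : ∀ i, MapsTo (f i) K K := fun i => mapsTo_cfBranch_Icc (hpos' i) fun d hd =>
    (Finset.le_sup (f := id) ((mem_evenWords_sdiff.1 (e.symm i).2).2.2.1 d hd)).trans
      (Nat.le_succ _)
  have hexp : ∀ i, ∀ y ∈ K, ∀ z ∈ K, ((2 * x) ^ 2)⁻¹ * dist y z ≤ dist (f i y) (f i z) := by
    intro i y hy z hz
    have hq := (mem_evenWords_sdiff.1 (e.symm i).2).2.2.2.2
    have hq0 : (0 : ℝ) < cont (e.symm i).1 := Nat.cast_pos.2 (cont_pos _ (hpos' i))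
    refine le_trans ?_ (le_abs_cfBranch_sub (hpos' i) (Ioo_subset_Icc_self (hK01 hy))
      (Ioo_subset_Icc_self (hK01 hz)))
    rw [Real.dist_eq, inv_mul_eq_div]
    gcongr
  have hdisj : ∀ i j, i ≠ j → Disjoint (f i '' K) (f j '' K) := by
    intro i j hij
    rw [Set.disjoint_left]
    rintro _ ⟨y, hy, rfl⟩ ⟨z, hz, hzy⟩
    refine hij (e.symm.injective (Subtype.ext ?_))
    rcases prefix_or_prefix_of_cfBranch_eq (hK01 hy) (hK01 hz) _ _ (hpos' i) (hpos' j) hzy.symm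
      with h | h
    · exact eq_of_isPrefix_of_mem_evenWords_sdiff hpos (e.symm i).2 (e.symm j).2 h
    · exact (eq_of_isPrefix_of_mem_evenWords_sdiff hpos (e.symm j).2 (e.symm i).2 h).symm
  have hinj : ∀ i, InjOn (f i) K := by
    intro i y hy z hz hyz
    have h1 := hexp i y hy z hz
    rw [hyz, dist_self] at h1
    exact dist_le_zero.1 (nonpos_of_mul_nonpos_right h1 (by positivity))
  have hdim : s ≤ dimH (ifsLimitSet f K) := by
    refine le_dimH_ifsLimitSet hM isCompact_Icc hKne hmaps (fun i => ?_) hdisj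
      (r := ((2 * x) ^ 2)⁻¹) (by positivity) hexp (by exact_mod_cast hs0) ?_
    · exact (lipschitzOnWith_cfBranch (hpos' i)).continuousOn.mono fun y hy => (hK01 hy).1.le
    · rw [Real.inv_rpow (by positivity), ← Real.rpow_natCast, ← Real.rpow_mul (by positivity),
        Nat.card_coe_set_eq]
      exact inv_anti₀ (by positivity) hs.le
  have hsub : ifsLimitSet f K ⊆ cfSet A := by
    refine subset_cfSet_of_forall_exists_cfBranch hpos
      (fun y hy => (hK01 (ifsLimitSet_subset hy)).1) fun y hy => ?_
    obtain ⟨i, z, hz, rfl⟩ := exists_eq_of_mem_ifsLimitSet hmaps hinj hy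
    obtain ⟨hne, -, hA, -⟩ := mem_evenWords_sdiff.1 (e.symm i).2
    exact ⟨_, hne, hA, z, hz, rfl⟩
  have hle := ENNReal.toReal_mono (dimH_cfSet_ne_top A) (hdim.trans (dimH_mono hsub))
  exact (show cfDim A < s from hsδ).not_ge hle

lemma FA_le (hpos : ∀ a ∈ A, 0 < a) (hδ : 1 / 2 < cfDim A) {x : ℝ} (hx : 0 < x) :
    (FA A x : ℝ) ≤ 8 * x ^ (2 * cfDim A) := by
  obtain ⟨n, hn⟩ := pow_unbounded_of_one_lt x one_lt_two
  induction n generalizing x with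
  | zero =>
    rw [FA_eq_zero_of_lt_two hpos (by linarith), Nat.cast_zero]
    positivity
  | succ n ih =>
    have h1 := ih (half_pos hx) (by rw [pow_succ] at hn; linarith)
    have h2 := ncard_evenWords_sdiff_half_le hpos hx
    rw [FA_eq_add_ncard_sdiff hpos (half_le_self hx.le), Nat.cast_add]
    have h3 : (2 : ℝ) ^ (2 * cfDim A) ≤ 4 := by
      calc (2 : ℝ) ^ (2 * cfDim A) ≤ 2 ^ (2 : ℝ) :=
            Real.rpow_le_rpow_of_exponent_le one_le_two (by linarith [cfDim_le_one A])
        _ = 4 := by norm_num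
    have h4 : (2 : ℝ) ≤ 2 ^ (2 * cfDim A) := by
      calc (2 : ℝ) = 2 ^ (1 : ℝ) := (Real.rpow_one 2).symm
        _ ≤ _ := Real.rpow_le_rpow_of_exponent_le one_le_two (by linarith)
    rw [Real.div_rpow hx.le two_pos.le] at h1
    rw [Real.mul_rpow two_pos.le hx.le] at h2
    have hX : 0 ≤ x ^ (2 * cfDim A) := by positivity
    have h5 : x ^ (2 * cfDim A) / 2 ^ (2 * cfDim A) ≤ x ^ (2 * cfDim A) / 2 := by gcongr
    have h6 := mul_le_mul_of_nonneg_right h3 hX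
    linarith

end Counting

/-- Theorem of Hensley type: for `δ_A > 1/2` and `x ≥ 4 A_max²`,
`x^{2δ_A}/(32 A_max⁴) ≤ F_A(x) − F_A(x/(4A_max²)) ≤ F_A(x) ≤ 8 x^{2δ_A}`. -/
theorem FA_bounds (A : Finset ℕ) (hcard : 2 ≤ A.card) (hpos : ∀ a ∈ A, 0 < a)
    (hA : A.Nonempty) (hδ : 1 / 2 < cfDim A)
    (x : ℝ) (hx : 4 * (A.max' hA : ℝ) ^ 2 ≤ x) :
    x ^ (2 * cfDim A) / (32 * (A.max' hA : ℝ) ^ 4) ≤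
        (FA A x : ℝ) - (FA A (x / (4 * (A.max' hA : ℝ) ^ 2)) : ℝ) ∧
      (FA A x : ℝ) - (FA A (x / (4 * (A.max' hA : ℝ) ^ 2)) : ℝ) ≤ (FA A x : ℝ) ∧
      (FA A x : ℝ) ≤ 8 * x ^ (2 * cfDim A) := by
  set N := A.max' hA
  have hN1 : (1 : ℝ) ≤ N := Nat.one_le_cast.2 (hpos N (A.max'_mem hA))
  have hc : 0 < 4 * (N : ℝ) ^ 2 := by positivity
  have hx0 : 0 < x := hc.trans_le hx
  have hy : 1 ≤ x / (4 * (N : ℝ) ^ 2) := (one_le_div hc).2 hx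
  have hsplit := FA_eq_add_ncard_sdiff hpos (div_le_self hx0.le (by nlinarith) :
    x / (4 * (N : ℝ) ^ 2) ≤ x)
  have hlow := rpow_le_ncard_evenWords_sdiff hpos (N := N) (fun a ha => A.le_max' a ha)
    (one_half_pos.trans hδ) hy
  rw [mul_div_cancel₀ x hc.ne'] at hlow
  refine ⟨?_, sub_le_self _ (Nat.cast_nonneg _), FA_le hpos hδ hx0⟩
  rw [hsplit, Nat.cast_add, add_sub_cancel_left]
  refine le_trans ?_ hlow
  rw [Real.div_rpow hx0.le hc.le]
  gcongr
  calc (4 * (N : ℝ) ^ 2) ^ (2 * cfDim A) ≤ (4 * (N : ℝ) ^ 2) ^ (2 : ℝ) :=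
        Real.rpow_le_rpow_of_exponent_le (by nlinarith) (by linarith [cfDim_le_one A])
    _ = 16 * (N : ℝ) ^ 4 := by rw [Real.rpow_two]; ring
    _ ≤ 32 * (N : ℝ) ^ 4 := by gcongr; norm_num
end

section
/- Let A ≥ 2 be an integer, ε₀ ∈ (0, 1/2500), and N > e a real number such that J := ⌊(log log N − 4·log(10A) + 2·log ε₀)/(−log(1−ε₀))⌋ satisfies J ≥ 10. Define the sequence N_j by N_{J+1} = N, N_j = N^{(1−ε₀)^{1−j}/(2−ε₀)} for −1−J ≤ j ≤ 1, and N_j = N^{1−(1−ε₀)^{j}/(2−ε₀)} for 0 ≤ j ≤ J. Then for every integer m with −J ≤ m ≤ J−1 one has N_{m+1}/N_m ≥ exp(10⁴·A⁴/(2ε₀)); moreover exp(10⁴·A⁴/(2ε₀²)) ≤ N/N_J = N_{1−J} ≤ exp(10⁵·A⁴/ε₀²). -/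
/-- The sequence `N_j`, `−J−1 ≤ j ≤ J+1`: `N_{J+1} = N`,
`N_j = N^{(1−ε₀)^{1−j}/(2−ε₀)}` for `j ≤ 1`, and
`N_j = N^{1−(1−ε₀)^{j}/(2−ε₀)}` for `2 ≤ j` (the two formulas agree for `j = 0, 1`). -/
noncomputable def Nseq (ε₀ N : ℝ) (J j : ℤ) : ℝ :=
  if j = J + 1 then N
  else if j ≤ 1 then N ^ ((1 - ε₀) ^ (1 - j) / (2 - ε₀))
  else N ^ (1 - (1 - ε₀) ^ j / (2 - ε₀))

theorem Nseq_eq_rpow_of_le_one {ε₀ N : ℝ} {J j : ℤ} (hjJ : j ≤ J) (hj : j ≤ 1) :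
    Nseq ε₀ N J j = N ^ ((1 - ε₀) ^ (1 - j) / (2 - ε₀)) := by
  rw [Nseq, if_neg (by lia), if_pos hj]

theorem Nseq_eq_rpow_of_one_le {ε₀ N : ℝ} {J j : ℤ} (hε : 2 - ε₀ ≠ 0) (hjJ : j ≤ J)
    (hj : 1 ≤ j) :
    Nseq ε₀ N J j = N ^ (1 - (1 - ε₀) ^ j / (2 - ε₀)) := by
  rcases hj.eq_or_lt with rfl | hj
  · rw [Nseq_eq_rpow_of_le_one hjJ le_rfl]
    congr 1
    simp only [sub_self, zpow_zero, zpow_one]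
    field_simp
    ring
  · rw [Nseq, if_neg (by lia), if_neg (by lia)]

/-- The geometric form of the bounds on `J` coming from the floor. -/
theorem zpow_floor_bounds {a L K : ℝ} (ha : 0 < a) (ha1 : a < 1) (hL : 0 < L) (hK : 0 < K)
    {J : ℤ} (hJ : J = ⌊(Real.log L - Real.log K) / (-Real.log a)⌋) :
    K ≤ L * a ^ J ∧ L * a ^ (J + 1) < K := by
  have hc : 0 < -Real.log a := neg_pos.2 (Real.log_neg ha ha1)
  obtain ⟨h1, h2⟩ := Int.floor_eq_iff.1 hJ.symm
  rw [le_div_iff₀ hc] at h1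
  rw [div_lt_iff₀ hc] at h2
  constructor
  · rw [← Real.log_le_log_iff hK (by positivity), Real.log_mul hL.ne' (by positivity),
      Real.log_zpow]
    linarith
  · rw [← Real.log_lt_log_iff (by positivity) hK, Real.log_mul hL.ne' (by positivity),
      Real.log_zpow]
    push_cast
    linarith

/-- for `−J ≤ m ≤ J−1` one has `N_{m+1}/N_m ≥ exp(10⁴A⁴/(2ε₀))`;
moreover `exp(10⁴A⁴/(2ε₀²)) ≤ N/N_J = N_{1−J} ≤ exp(10⁵A⁴/ε₀²)`. -/
theorem Nseq_ratio_bounds (A : ℕ) (hA : 2 ≤ A)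
    (ε₀ : ℝ) (hε : 0 < ε₀) (hε' : ε₀ < 1 / 2500)
    (N : ℝ) (hN : Real.exp 1 < N) (J : ℤ)
    (hJdef : J = ⌊(Real.log (Real.log N) - 4 * Real.log (10 * A) + 2 * Real.log ε₀) /
      (-Real.log (1 - ε₀))⌋)
    (hJ : 10 ≤ J) :
    (∀ m : ℤ, -J ≤ m → m ≤ J - 1 →
      Real.exp (10 ^ 4 * (A : ℝ) ^ 4 / (2 * ε₀)) ≤ Nseq ε₀ N J (m + 1) / Nseq ε₀ N J m) ∧
    Real.exp (10 ^ 4 * (A : ℝ) ^ 4 / (2 * ε₀ ^ 2)) ≤ N / Nseq ε₀ N J J ∧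
    N / Nseq ε₀ N J J = Nseq ε₀ N J (1 - J) ∧
    Nseq ε₀ N J (1 - J) ≤ Real.exp (10 ^ 5 * (A : ℝ) ^ 4 / ε₀ ^ 2) := by
  have hN0 : 0 < N := (Real.exp_pos 1).trans hN
  have hL : 0 < Real.log N := Real.log_pos ((Real.one_lt_exp_iff.2 one_pos).trans hN)
  have ha : 0 < 1 - ε₀ := by linarith
  have hd : 0 < 2 - ε₀ := by linarith
  have hA0 : (0 : ℝ) < A := by
    have : 0 < A := by lia
    exact_mod_cast this
  set K : ℝ := 10 ^ 4 * (A : ℝ) ^ 4 / ε₀ ^ 2 with hKdef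
  have hK : 0 < K := by positivity
  have hlogK : Real.log K = 4 * Real.log (10 * A) - 2 * Real.log ε₀ := by
    rw [hKdef, ← mul_pow, Real.log_div (by positivity) (by positivity), Real.log_pow,
      Real.log_pow]
    push_cast
    ring
  obtain ⟨hlow, hupp⟩ := zpow_floor_bounds (J := J) ha (by linarith) hL hK (by
    rw [hJdef, hlogK]
    congr 2
    ring)
  have hexp (x : ℝ) : N ^ x = Real.exp (Real.log N * x) := Real.rpow_def_of_pos hN0 x
  have hNJ : N / Nseq ε₀ N J J = N ^ ((1 - ε₀) ^ J / (2 - ε₀)) := by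
    rw [Nseq_eq_rpow_of_one_le hd.ne' le_rfl (by lia)]
    nth_rewrite 1 [← Real.rpow_one N]
    rw [← Real.rpow_sub hN0]
    congr 1
    ring
  have hN1J : Nseq ε₀ N J (1 - J) = N ^ ((1 - ε₀) ^ J / (2 - ε₀)) := by
    rw [Nseq_eq_rpow_of_le_one (by lia) (by lia), sub_sub_cancel]
  have hstep (k : ℤ) (hk : k ≤ J) :
      Real.exp (10 ^ 4 * (A : ℝ) ^ 4 / (2 * ε₀)) ≤
        N ^ (((1 - ε₀) ^ k - (1 - ε₀) ^ (k + 1)) / (2 - ε₀)) := by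
    have hmono : (1 - ε₀) ^ J ≤ (1 - ε₀) ^ k :=
      zpow_le_zpow_right_of_le_one₀ ha (by linarith) hk
    have hKk : K ≤ Real.log N * (1 - ε₀) ^ k :=
      hlow.trans (mul_le_mul_of_nonneg_left hmono hL.le)
    rw [hexp, Real.exp_le_exp, zpow_add_one₀ ha.ne']
    calc 10 ^ 4 * (A : ℝ) ^ 4 / (2 * ε₀) = K * ε₀ / 2 := by
          rw [hKdef]
          field_simp
      _ ≤ K * ε₀ / (2 - ε₀) := by
          gcongr
          linarith
      _ ≤ Real.log N * (1 - ε₀) ^ k * ε₀ / (2 - ε₀) := by gcongr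
      _ = _ := by ring
  refine ⟨fun m hm hm' => ?_, ?_, hNJ.trans hN1J.symm, ?_⟩
  · rcases le_or_gt m 0 with h | h
    · rw [Nseq_eq_rpow_of_le_one (by lia) (by lia), Nseq_eq_rpow_of_le_one (by lia) (by lia),
        ← Real.rpow_sub hN0]
      convert hstep (-m) (by lia) using 2
      rw [show 1 - (m + 1) = -m by ring, show 1 - m = -m + 1 by ring]
      ring
    · rw [Nseq_eq_rpow_of_one_le hd.ne' (by lia) (by lia),
        Nseq_eq_rpow_of_one_le hd.ne' (by lia) (by lia), ← Real.rpow_sub hN0]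
      convert hstep m (by lia) using 2
      ring
  · rw [hNJ, hexp, Real.exp_le_exp]
    calc 10 ^ 4 * (A : ℝ) ^ 4 / (2 * ε₀ ^ 2) = K / 2 := by
          rw [hKdef]
          field_simp
      _ ≤ K / (2 - ε₀) := by
          gcongr
          linarith
      _ ≤ Real.log N * (1 - ε₀) ^ J / (2 - ε₀) := by gcongr
      _ = _ := by ring
  · rw [hN1J, hexp, Real.exp_le_exp]
    rw [zpow_add_one₀ ha.ne', ← mul_assoc] at hupp
    have hX : 0 ≤ Real.log N * (1 - ε₀) ^ J := by positivity
    rw [← mul_div_assoc, div_le_iff₀ hd]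
    have hK10 : 10 ^ 5 * (A : ℝ) ^ 4 / ε₀ ^ 2 = 10 * K := by
      rw [hKdef]
      ring
    rw [hK10]
    nlinarith
end

section
/- Let A ≥ 2 be an integer, ε₀ ∈ (0, 1/2500), and N > e a real number such that J := ⌊(log log N − 4·log(10A) + 2·log ε₀)/(−log(1−ε₀))⌋ satisfies J ≥ 10, and define the sequence N_j as above. Then for every real M with N_{1−J} ≤ M ≤ N_J there exist integers j and h with 2 ≤ j ≤ 2J, 1 ≤ h ≤ 2J−1, and h = 2J − j + 1, such that N_{j−J}^{1−ε₀} ≤ M ≤ N_{j−J} and (N/N_{h−J})^{1−ε₀} ≤ M ≤ N/N_{h−J}. -/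
/-- The exponent of `N` in `Nseq ε₀ N J j`, away from `j = J + 1`. -/
noncomputable def Nexp (ε₀ : ℝ) (j : ℤ) : ℝ :=
  if j ≤ 1 then (1 - ε₀) ^ (1 - j) / (2 - ε₀) else 1 - (1 - ε₀) ^ j / (2 - ε₀)

theorem Nseq_eq_rpow_Nexp (ε₀ N : ℝ) {J j : ℤ} (hj : j ≠ J + 1) :
    Nseq ε₀ N J j = N ^ Nexp ε₀ j := by
  rw [Nseq, Nexp, if_neg hj]
  split_ifs <;> rfl

theorem Nexp_add_Nexp_one_sub {ε₀ : ℝ} (hε : ε₀ < 1) (j : ℤ) :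
    Nexp ε₀ j + Nexp ε₀ (1 - j) = 1 := by
  have h2 : 2 - ε₀ ≠ 0 := by linarith
  unfold Nexp
  split_ifs with h1 h3 h3
  · obtain rfl | rfl : j = 0 ∨ j = 1 := by omega
    all_goals
      norm_num
      field_simp
      ring
  · ring
  · rw [sub_sub_cancel]
    ring
  · omega

theorem one_sub_mul_Nexp_le {ε₀ : ℝ} (hε : 0 < ε₀) (hε' : ε₀ < 1) (j : ℤ) :
    Nexp ε₀ j * (1 - ε₀) ≤ Nexp ε₀ (j - 1) := by
  have h2 : 0 < 2 - ε₀ := by linarith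
  have hq : 0 < 1 - ε₀ := by linarith
  by_cases h1 : j ≤ 1
  · rw [Nexp, Nexp, if_pos h1, if_pos (by omega), show 1 - (j - 1) = (1 - j) + 1 by ring,
      zpow_add_one₀ hq.ne']
    exact le_of_eq (by ring)
  · have key : Nexp ε₀ (j - 1) = 1 - (1 - ε₀) ^ (j - 1) / (2 - ε₀) := by
      unfold Nexp
      split_ifs with h3
      · obtain rfl : j = 2 := by omega
        norm_num
        field_simp
        ring
      · rfl
    rw [key, Nexp, if_neg h1]
    have hle : (1 - ε₀) ^ (j - 1) ≤ 1 := by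
      lift j - 1 to ℕ using by omega with n
      rw [zpow_natCast]
      exact pow_le_one₀ hq.le (by linarith)
    have hj : (1 - ε₀) ^ j = (1 - ε₀) ^ (j - 1) * (1 - ε₀) := by
      rw [← zpow_add_one₀ hq.ne', sub_add_cancel]
    rw [hj]
    have hdiff : 1 - (1 - ε₀) ^ (j - 1) / (2 - ε₀)
        - (1 - (1 - ε₀) ^ (j - 1) * (1 - ε₀) / (2 - ε₀)) * (1 - ε₀)
        = ε₀ * (1 - (1 - ε₀) ^ (j - 1)) := by
      field_simp
      ring
    nlinarith [mul_nonneg hε.le (sub_nonneg.2 hle)]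

theorem exists_le_le_succ_of_int {f : ℤ → ℝ} {a b : ℤ} (hab : a < b) {M : ℝ}
    (ha : f a ≤ M) (hb : M ≤ f b) : ∃ k, a < k ∧ k ≤ b ∧ f (k - 1) ≤ M ∧ M ≤ f k := by
  induction b, hab using Int.leInduction with
  | base => exact ⟨a + 1, by omega, le_rfl, by simpa using ha, hb⟩
  | succ n hn ih =>
    by_cases h : M ≤ f n
    · obtain ⟨k, h1, h2, h3⟩ := ih h
      exact ⟨k, h1, by omega, h3⟩
    · exact ⟨n + 1, by omega, le_rfl, by simpa using (not_le.1 h).le, hb⟩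

/-- for every `M ∈ [N_{1−J}, N_J]` there exist `j, h` with `2 ≤ j ≤ 2J`,
`1 ≤ h ≤ 2J−1`, `h = 2J−j+1`, `N_{j−J}^{1−ε₀} ≤ M ≤ N_{j−J}` and
`(N/N_{h−J})^{1−ε₀} ≤ M ≤ N/N_{h−J}`. -/
theorem Nseq_localization (A : ℕ) (hA : 2 ≤ A)
    (ε₀ : ℝ) (hε : 0 < ε₀) (hε' : ε₀ < 1 / 2500)
    (N : ℝ) (hN : Real.exp 1 < N) (J : ℤ)
    (hJdef : J = ⌊(Real.log (Real.log N) - 4 * Real.log (10 * A) + 2 * Real.log ε₀) /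
      (-Real.log (1 - ε₀))⌋)
    (hJ : 10 ≤ J) :
    ∀ M : ℝ, Nseq ε₀ N J (1 - J) ≤ M → M ≤ Nseq ε₀ N J J →
      ∃ j h : ℤ, 2 ≤ j ∧ j ≤ 2 * J ∧ 1 ≤ h ∧ h ≤ 2 * J - 1 ∧ h = 2 * J - j + 1 ∧
        Nseq ε₀ N J (j - J) ^ (1 - ε₀) ≤ M ∧ M ≤ Nseq ε₀ N J (j - J) ∧
        (N / Nseq ε₀ N J (h - J)) ^ (1 - ε₀) ≤ M ∧ M ≤ N / Nseq ε₀ N J (h - J) := by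
  intro M hM1 hM2
  have hN1 : 1 < N := (Real.one_lt_exp_iff.2 one_pos).trans hN
  have hN0 : 0 < N := one_pos.trans hN1
  have hε1 : ε₀ < 1 := by linarith
  obtain ⟨k, hk1, hk2, hk3, hk4⟩ := exists_le_le_succ_of_int (by omega) hM1 hM2
  have hdual : N / Nseq ε₀ N J (1 - k) = Nseq ε₀ N J k := by
    rw [Nseq_eq_rpow_Nexp _ _ (by omega), Nseq_eq_rpow_Nexp _ _ (by omega),
      eq_sub_of_add_eq (Nexp_add_Nexp_one_sub hε1 k),
      Real.rpow_sub hN0, Real.rpow_one]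
  have hlow : Nseq ε₀ N J k ^ (1 - ε₀) ≤ M := by
    refine le_trans ?_ hk3
    rw [Nseq_eq_rpow_Nexp _ _ (by omega), Nseq_eq_rpow_Nexp _ _ (by omega),
      ← Real.rpow_mul hN0.le]
    exact Real.rpow_le_rpow_of_exponent_le hN1.le (one_sub_mul_Nexp_le hε hε1 k)
  refine ⟨k + J, J - k + 1, by omega, by omega, by omega, by omega, by ring, ?_⟩
  rw [add_sub_cancel_right, show J - k + 1 - J = 1 - k by ring, hdual]
  exact ⟨hlow, hk4, hlow, hk4⟩
end

section
/- Let A ≥ 2 be an integer, ε₀ ∈ (0, 1/2500), and N > e a real number such that J := ⌊(log log N − 4·log(10A) + 2·log ε₀)/(−log(1−ε₀))⌋ satisfies J ≥ 10, and define the sequence N_j as above. Set Ñ_{n−J} = N_{n−J} for integers n ≥ 1 and Ñ_{−J} = 1, and for integers 0 ≤ j < h ≤ 2J+1 set j₀(j,h) = min{|n−J−1| : j+1 ≤ n ≤ h}. Then for all integers 0 ≤ j < h ≤ 2J+1 one has ∏_{n=j+1}^{h} (2⁹·A³·log(N_{n−J}/Ñ_{n−1−J})) ≤ ((1−ε₀)^{j₀(j,h)}·log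 N)^{(7/4)·(h−j)}. -/
/-- `Ñ_{n−J}`: equal to `N_{n−J}` for `n ≥ 1` and to `1` for `n = 0`. -/
noncomputable def Ntil (ε₀ N : ℝ) (J n : ℤ) : ℝ :=
  if 1 ≤ n then Nseq ε₀ N J (n - J) else 1

/-- The exponent `e` for which `N_j = N ^ e`. -/
noncomputable def NseqExponent (ε₀ : ℝ) (J j : ℤ) : ℝ :=
  if j = J + 1 then 1
  else if j ≤ 1 then (1 - ε₀) ^ (1 - j) / (2 - ε₀)
  else 1 - (1 - ε₀) ^ j / (2 - ε₀)

theorem Nseq_eq_rpow (ε₀ N : ℝ) (J j : ℤ) :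
    Nseq ε₀ N J j = N ^ NseqExponent ε₀ J j := by
  unfold Nseq NseqExponent
  split_ifs <;> simp

theorem NseqExponent_first {ε₀ : ℝ} (h0 : 0 < ε₀) (h1 : ε₀ < 1) {J : ℤ} (hJ : 1 ≤ J) :
    0 ≤ NseqExponent ε₀ J (1 - J) ∧ NseqExponent ε₀ J (1 - J) ≤ (1 - ε₀) ^ J := by
  have hr : 0 < (1 - ε₀) ^ J := zpow_pos (by linarith) _
  have hd : 0 < 2 - ε₀ := by linarith
  rw [NseqExponent, if_neg (by omega), if_pos (by omega), sub_sub_cancel]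
  exact ⟨by positivity, div_le_self hr.le (by linarith)⟩

theorem NseqExponent_sub {ε₀ : ℝ} (h0 : 0 < ε₀) (h1 : ε₀ < 1) {J k : ℤ} (hJ : 1 ≤ J)
    (hkJ : k ≤ J + 1) :
    0 ≤ NseqExponent ε₀ J k - NseqExponent ε₀ J (k - 1) ∧
      NseqExponent ε₀ J k - NseqExponent ε₀ J (k - 1) ≤ (1 - ε₀) ^ |k - 1| := by
  have hr0 : (1 - ε₀) ≠ 0 := by linarith
  have hr : 0 < (1 - ε₀) ^ |k - 1| := zpow_pos (by linarith) _
  have hd : 0 < 2 - ε₀ := by linarith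
  have interior : ∀ x, x = (1 - ε₀) ^ |k - 1| * (ε₀ / (2 - ε₀)) →
      0 ≤ x ∧ x ≤ (1 - ε₀) ^ |k - 1| := by
    rintro x rfl
    refine ⟨by positivity, mul_le_of_le_one_right hr.le ?_⟩
    rw [div_le_one hd]
    linarith
  rcases lt_trichotomy k (J + 1) with hk | rfl | hk
  · rcases le_or_gt k 1 with hk1 | hk1
    · apply interior
      rw [NseqExponent, NseqExponent, if_neg hk.ne, if_pos hk1, if_neg (by omega),
        if_pos (by omega), abs_of_nonpos (by omega), show 1 - (k - 1) = (1 - k) + 1 by ring,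
        zpow_add_one₀ hr0, show -(k - 1) = 1 - k by ring]
      field_simp
      ring
    · apply interior
      have hpow : (1 - ε₀) ^ k = (1 - ε₀) ^ (k - 1) * (1 - ε₀) := by
        rw [← zpow_add_one₀ hr0, sub_add_cancel]
      rw [NseqExponent, NseqExponent, if_neg hk.ne, if_neg (by omega), if_neg (by omega),
        abs_of_nonneg (by omega), hpow]
      split_ifs with hk2
      · obtain rfl : k = 2 := by omega
        norm_num
        field_simp
        ring
      · field_simp
        ring
  · rw [add_sub_cancel_right, abs_of_nonneg (by omega)] at *
    have hle : (1 - ε₀) ^ J / (2 - ε₀) ≤ (1 - ε₀) ^ J := div_le_self hr.le (by linarith)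
    have hpos : 0 ≤ (1 - ε₀) ^ J / (2 - ε₀) := by positivity
    rw [NseqExponent, NseqExponent, if_pos rfl, if_neg (by omega)]
    split_ifs with hJ1
    · obtain rfl : J = 1 := by omega
      norm_num at hle hpos ⊢
      have : 1 - (2 - ε₀)⁻¹ = (1 - ε₀) / (2 - ε₀) := by
        field_simp
        ring
      constructor <;> linarith
    · constructor <;> linarith
  · omega

theorem log_Nseq_div_Ntil_bounds {ε₀ N : ℝ} (h0 : 0 < ε₀) (h1 : ε₀ < 1) (hN : 1 ≤ N)
    {J n : ℤ} (hJ : 1 ≤ J) (hn : 1 ≤ n) (hnJ : n ≤ 2 * J + 1) :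
    0 ≤ Real.log (Nseq ε₀ N J (n - J) / Ntil ε₀ N J (n - 1)) ∧
      Real.log (Nseq ε₀ N J (n - J) / Ntil ε₀ N J (n - 1)) ≤
        (1 - ε₀) ^ |n - J - 1| * Real.log N := by
  have hN0 : 0 < N := by linarith
  have hL : 0 ≤ Real.log N := Real.log_nonneg hN
  unfold Ntil
  split_ifs with hn1
  · obtain ⟨hl, hu⟩ := NseqExponent_sub h0 h1 hJ (show n - J ≤ J + 1 by omega)
    rw [show n - 1 - J = n - J - 1 by ring, Nseq_eq_rpow, Nseq_eq_rpow, ← Real.rpow_sub hN0,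
      Real.log_rpow hN0]
    exact ⟨mul_nonneg hl hL, mul_le_mul_of_nonneg_right hu hL⟩
  · obtain rfl : n = 1 := by omega
    obtain ⟨hl, hu⟩ := NseqExponent_first h0 h1 hJ
    rw [div_one, Nseq_eq_rpow, Real.log_rpow hN0, show (1 - J - 1 : ℤ) = -J by ring, abs_neg,
      abs_of_nonneg (by omega)]
    exact ⟨mul_nonneg hl hL, mul_le_mul_of_nonneg_right hu hL⟩

theorem pow_four_le_zpow_mul_of_le_floor {ε₀ L B : ℝ} (h0 : 0 < ε₀) (h1 : ε₀ < 1) (hL : 0 < L)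
    (hB : 0 < B) {J : ℤ}
    (hJ : J ≤ ⌊(Real.log L - 4 * Real.log B + 2 * Real.log ε₀) / (-Real.log (1 - ε₀))⌋) :
    B ^ 4 ≤ (1 - ε₀) ^ J * L := by
  have hr : 0 < 1 - ε₀ := by linarith
  have hlogr : 0 < -Real.log (1 - ε₀) := neg_pos.2 (Real.log_neg hr (by linarith))
  have hJ' := Int.le_floor.1 hJ
  rw [le_div_iff₀ hlogr] at hJ'
  rw [← Real.log_le_log_iff (by positivity) (by positivity), Real.log_pow,
    Real.log_mul (by positivity) hL.ne', Real.log_zpow]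
  have := Real.log_neg h0 h1
  push_cast
  linarith

/-- for `0 ≤ j < h ≤ 2J+1`, with `j₀ = j₀(j,h) = min{|n−J−1| : j+1 ≤ n ≤ h}`,
one has `∏_{n=j+1}^{h} (2⁹A³ log(N_{n−J}/Ñ_{n−1−J})) ≤ ((1−ε₀)^{j₀} log N)^{(7/4)(h−j)}`. -/
theorem Nseq_log_product_bound (A : ℕ) (hA : 2 ≤ A)
    (ε₀ : ℝ) (hε : 0 < ε₀) (hε' : ε₀ < 1 / 2500)
    (N : ℝ) (hN : Real.exp 1 < N) (J : ℤ)
    (hJdef : J = ⌊(Real.log (Real.log N) - 4 * Real.log (10 * A) + 2 * Real.log ε₀) /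
      (-Real.log (1 - ε₀))⌋)
    (hJ : 10 ≤ J)
    (j h : ℤ) (hj0 : 0 ≤ j) (hjh : j < h) (hh : h ≤ 2 * J + 1)
    (j₀ : ℤ)
    (hj₀lb : ∀ n : ℤ, j + 1 ≤ n → n ≤ h → j₀ ≤ |n - J - 1|)
    (hj₀mem : ∃ n : ℤ, j + 1 ≤ n ∧ n ≤ h ∧ j₀ = |n - J - 1|) :
    ∏ n ∈ Finset.Icc (j + 1) h,
        (2 ^ 9 * (A : ℝ) ^ 3 * Real.log (Nseq ε₀ N J (n - J) / Ntil ε₀ N J (n - 1))) ≤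
      ((1 - ε₀) ^ j₀ * Real.log N) ^ ((7 / 4 : ℝ) * ((h : ℝ) - (j : ℝ))) := by
  have hr : 0 < 1 - ε₀ := by linarith
  have hε1 : ε₀ < 1 := by linarith
  have hN1 : 1 < N := (Real.one_lt_exp_iff.2 one_pos).trans hN
  have hL : 0 < Real.log N := Real.log_pos hN1
  have hA0 : (0 : ℝ) < A := by exact_mod_cast (by omega : 0 < A)
  set X : ℝ := (1 - ε₀) ^ j₀ * Real.log N
  have hj₀J : j₀ ≤ J := by
    obtain ⟨n, hn1, hn2, rfl⟩ := hj₀mem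
    rw [abs_le]
    omega
  have hX4 : (10 * A : ℝ) ^ 4 ≤ X :=
    (pow_four_le_zpow_mul_of_le_floor hε hε1 hL (by positivity) hJdef.le).trans
      (mul_le_mul_of_nonneg_right
        (zpow_le_zpow_right_of_le_one₀ hr (by linarith) hj₀J) hL.le)
  have hX0 : 0 < X := by positivity
  have hconst : 2 ^ 9 * (A : ℝ) ^ 3 ≤ X ^ (3 / 4 : ℝ) := calc
    2 ^ 9 * (A : ℝ) ^ 3 ≤ (10 * A : ℝ) ^ 3 := by
      rw [mul_pow]
      gcongr
      norm_num
    _ = ((10 * A : ℝ) ^ 4) ^ (3 / 4 : ℝ) := by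
      rw [← Real.rpow_natCast _ 4, ← Real.rpow_mul (by positivity), ← Real.rpow_natCast _ 3]
      norm_num
    _ ≤ X ^ (3 / 4 : ℝ) := by gcongr
  have hcard : (((Finset.Icc (j + 1) h).card : ℕ) : ℝ) = (h : ℝ) - j := by
    have hc : (((Finset.Icc (j + 1) h).card : ℕ) : ℤ) = h - j := by
      rw [Int.card_Icc]
      omega
    exact_mod_cast hc
  calc
    _ ≤ ∏ _n ∈ Finset.Icc (j + 1) h, X ^ (7 / 4 : ℝ) := by
      apply Finset.prod_le_prod
      · intro n hn
        rw [Finset.mem_Icc] at hn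
        have := (log_Nseq_div_Ntil_bounds hε hε1 hN1.le (J := J) (n := n)
          (by omega) (by omega) (by omega)).1
        positivity
      · intro n hn
        rw [Finset.mem_Icc] at hn
        obtain ⟨hl, hu⟩ := log_Nseq_div_Ntil_bounds hε hε1 hN1.le (J := J) (n := n)
          (by omega) (by omega) (by omega)
        have hle := hu.trans (mul_le_mul_of_nonneg_right
          (zpow_le_zpow_right_of_le_one₀ hr (by linarith) (hj₀lb n hn.1 hn.2)) hL.le)
        calc
          _ ≤ X ^ (3 / 4 : ℝ) * X := mul_le_mul hconst hle hl (by positivity)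
          _ = X ^ (7 / 4 : ℝ) := by
            rw [← Real.rpow_add_one hX0.ne']
            norm_num
    _ = X ^ ((7 / 4 : ℝ) * ((h : ℝ) - (j : ℝ))) := by
      rw [Finset.prod_const, ← Real.rpow_natCast, ← Real.rpow_mul hX0.le, hcard]
end

section
/- Let N ≥ 1 be an integer, Ω a finite set, n : Ω → ℤ a function, and S(θ) = ∑_{γ∈Ω} e(n(γ)·θ). Then ∫₀¹ |S(θ)|² dθ ≤ (1/N) · ∑_{q,a} ∫_{|K| ≤ √N/q} |S(a/q + K/N)|² dK, where the sum runs over integers q with 1 ≤ q ≤ √N and integers a with 0 ≤ a ≤ q and gcd(a,q) = 1, and the integral is over real K with |K| ≤ √N/q. -/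
open MeasureTheory in
/-- The integral of a nonnegative function over a set covered by finitely many sets is at most the
sum of the integrals over these sets. -/
theorem setIntegral_le_sum_of_subset_biUnion {α ι : Type*} [MeasurableSpace α] {μ : Measure α}
    {f : α → ℝ} (hf : 0 ≤ f) {s : Set α} (t : Finset ι) {u : ι → Set α}
    (hs : MeasurableSet s) (hu : ∀ i ∈ t, MeasurableSet (u i))
    (hfu : ∀ i ∈ t, IntegrableOn f (u i) μ) (h : s ⊆ ⋃ i ∈ t, u i) :
    ∫ x in s, f x ∂μ ≤ ∑ i ∈ t, ∫ x in u i, f x ∂μ := by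
  have hint : ∀ i ∈ t, Integrable ((u i).indicator f) μ := fun i hi =>
    (hfu i hi).integrable_indicator (hu i hi)
  have hsum : ∑ i ∈ t, ∫ x in u i, f x ∂μ = ∫ x, ∑ i ∈ t, (u i).indicator f x ∂μ := by
    rw [integral_finsetSum _ hint]
    exact Finset.sum_congr rfl fun i hi => (integral_indicator (hu i hi)).symm
  rw [hsum, ← integral_indicator hs]
  refine integral_mono_of_nonneg (.of_forall fun x => Set.indicator_nonneg (fun y _ => hf y) x)
    (integrable_finsetSum _ hint) (.of_forall fun x => ?_)
  have hnn : ∀ i ∈ t, 0 ≤ (u i).indicator f x := fun i _ =>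
    Set.indicator_nonneg (fun y _ => hf y) x
  by_cases hx : x ∈ s
  · obtain ⟨i, hi, hxi⟩ := Set.mem_iUnion₂.1 (h hx)
    simp only [Set.indicator_of_mem hx]
    rw [← Set.indicator_of_mem hxi f]
    exact Finset.single_le_sum hnn hi
  · simp only [Set.indicator_of_notMem hx]
    exact Finset.sum_nonneg hnn

/-- **Dirichlet's approximation theorem** on the unit interval: the approximating fraction may be
taken in lowest terms with numerator between `0` and the denominator. -/
theorem exists_coprime_abs_sub_div_le {θ : ℝ} (h0 : 0 ≤ θ) (h1 : θ ≤ 1) {Q : ℕ} (hQ : 0 < Q) :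
    ∃ q ∈ Finset.Icc 1 Q, ∃ a ∈ (Finset.Icc 0 q).filter (fun a => Nat.gcd a q = 1),
      |θ - (a : ℝ) / q| ≤ 1 / ((Q + 1) * q) := by
  obtain ⟨r, hr, hrQ⟩ := Real.exists_rat_abs_sub_le_and_den_le θ hQ
  have hd : (0 : ℝ) < r.den := by exact_mod_cast r.den_pos
  have hQ' : (0 : ℝ) < Q := by exact_mod_cast hQ
  have hlt : 1 / (((Q : ℝ) + 1) * r.den) < 1 / r.den :=
    one_div_lt_one_div_of_lt hd (by nlinarith)
  have hcast : (r : ℝ) = (r.num : ℝ) / r.den := by exact_mod_cast (Rat.num_div_den r).symm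
  obtain ⟨hl, hu⟩ := abs_lt.1 (hr.trans_lt hlt)
  rw [hcast] at hl hu
  have hnum0 : 0 ≤ r.num := by
    have : (-1 : ℝ) < r.num := by
      have h : -1 / (r.den : ℝ) < r.num / r.den := by rw [neg_div]; linarith
      exact (div_lt_div_iff_of_pos_right hd).1 h
    have : -1 < r.num := by exact_mod_cast this
    omega
  have hnum1 : r.num ≤ r.den := by
    have : (r.num : ℝ) < r.den + 1 := by
      have h : (r.num : ℝ) / r.den < (r.den + 1) / r.den := by
        rw [add_div, div_self hd.ne']; linarith
      exact (div_lt_div_iff_of_pos_right hd).1 h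
    have : r.num < r.den + 1 := by exact_mod_cast this
    omega
  refine ⟨r.den, Finset.mem_Icc.2 ⟨r.den_pos, hrQ⟩, r.num.natAbs,
    Finset.mem_filter.2 ⟨Finset.mem_Icc.2 ⟨Nat.zero_le _, by omega⟩, r.reduced⟩, ?_⟩
  have hnat : ((r.num.natAbs : ℕ) : ℝ) = r.num := by
    rw [Nat.cast_natAbs, abs_of_nonneg hnum0]
  rwa [hnat, ← hcast]


/-- splitting `∫₀¹|S|²` along Dirichlet (Farey) arcs:
`∫₀¹|S(θ)|²dθ ≤ (1/N) ∑_{1 ≤ q ≤ √N} ∑_{0 ≤ a ≤ q, (a,q)=1} ∫_{|K| ≤ √N/q} |S(a/q + K/N)|² dK`. -/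
theorem integral_le_sum_farey_arcs (N : ℕ) (hN : 1 ≤ N)
    (Ω : Type) [Fintype Ω] (n : Ω → ℤ) :
    (∫ θ in (0:ℝ)..1,
        ‖∑ γ : Ω, Complex.exp (2 * Real.pi * Complex.I * (n γ : ℂ) * (θ : ℂ))‖ ^ 2) ≤
      (1 / (N : ℝ)) * ∑ q ∈ Finset.Icc 1 (Nat.sqrt N),
        ∑ a ∈ (Finset.Icc 0 q).filter (fun a => Nat.gcd a q = 1),
          ∫ K in (-(Real.sqrt N / q))..(Real.sqrt N / q),
            ‖∑ γ : Ω, Complex.exp (2 * Real.pi * Complex.I * (n γ : ℂ) *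
              ((((a : ℝ) / q + K / N) : ℝ) : ℂ))‖ ^ 2 := by
  set F : ℝ → ℝ := fun θ =>
    ‖∑ γ : Ω, Complex.exp (2 * Real.pi * Complex.I * (n γ : ℂ) * (θ : ℂ))‖ ^ 2 with hF
  have hFc : Continuous F := by fun_prop
  have hF0 : 0 ≤ F := fun θ => sq_nonneg _
  have hN0 : (0 : ℝ) < N := by exact_mod_cast hN
  have hs0 : 0 < Real.sqrt N := Real.sqrt_pos.2 hN0
  let w : ℕ → ℝ := fun q => Real.sqrt N / q / N
  have hw : ∀ q : ℕ, 0 ≤ w q := fun q => by positivity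
  have harc : ∀ q a : ℕ, (1 / (N : ℝ)) *
      ∫ K in (-(Real.sqrt N / q))..(Real.sqrt N / q), F ((a : ℝ) / q + K / N) =
      ∫ θ in Set.Icc ((a : ℝ) / q - w q) (a / q + w q), F θ := fun q a => by
    rw [MeasureTheory.integral_Icc_eq_integral_Ioc,
      ← intervalIntegral.integral_of_le (by linarith [hw q]),
      intervalIntegral.integral_comp_add_div F hN0.ne', smul_eq_mul, ← mul_assoc,
      one_div_mul_cancel hN0.ne', one_mul, neg_div, ← sub_eq_add_neg]
  change ∫ θ in (0 : ℝ)..1, F θ ≤ (1 / (N : ℝ)) * ∑ q ∈ Finset.Icc 1 (Nat.sqrt N),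
    ∑ a ∈ (Finset.Icc 0 q).filter (fun a => Nat.gcd a q = 1),
      ∫ K in (-(Real.sqrt N / q))..(Real.sqrt N / q), F ((a : ℝ) / q + K / N)
  simp only [Finset.mul_sum, harc]
  rw [intervalIntegral.integral_of_le zero_le_one, Finset.sum_sigma']
  refine setIntegral_le_sum_of_subset_biUnion hF0 _ measurableSet_Ioc
    (fun _ _ => measurableSet_Icc) (fun _ _ => hFc.integrableOn_Icc) fun θ hθ => ?_
  obtain ⟨q, hq, a, ha, h⟩ :=
    exists_coprime_abs_sub_div_le hθ.1.le hθ.2 (Nat.sqrt_pos.2 hN)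
  refine Set.mem_iUnion₂.2 ⟨⟨q, a⟩, Finset.mem_sigma.2 ⟨hq, ha⟩, ?_⟩
  have hq0 : (0 : ℝ) < q := by exact_mod_cast (Finset.mem_Icc.1 hq).1
  have hsqrt : Real.sqrt N ≤ Nat.sqrt N + 1 := Real.real_sqrt_le_nat_sqrt_succ
  have hwq : w q = 1 / (Real.sqrt N * q) := by
    have hsq : Real.sqrt N * Real.sqrt N = N := Real.mul_self_sqrt hN0.le
    simp only [w]
    rw [div_div, div_eq_div_iff (by positivity) (by positivity)]
    linear_combination (q : ℝ) * hsq
  have hle : |θ - (a : ℝ) / q| ≤ w q := by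
    rw [hwq]
    exact h.trans (by gcongr)
  obtain ⟨hl, hu⟩ := abs_le.1 hle
  exact ⟨by linarith, by linarith⟩
end

section
/- There is an absolute constant c > 0 with the following property. Let W be a finite set with #W > 10, let f : W → ℝ be nonnegative, and let C₁, C₂ ≥ 0 be constants such that for every subset Z ⊆ W one has ∑_{θ∈Z} f(θ) ≤ C₁·(#Z)^{1/2} + C₂. Then ∑_{θ∈W} f(θ)² ≤ c·(C₁²·log(#W) + C₂·max_{θ∈W} f(θ)). -/
/-- If all sums of `f` over subsets of `W` are at most `C₁ √#Z + C₂`, the second moment of `f` is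
controlled by the harmonic number of `#W` and any upper bound `M` of `f` on `W`. -/
theorem sum_sq_le_of_sum_le_sqrt_card {α : Type*} {f : α → ℝ} {C₁ C₂ M : ℝ}
    (hC₂ : 0 ≤ C₂) (hM : 0 ≤ M) (n : ℕ) (W : Finset α) (hn : W.card = n)
    (hf : ∀ θ ∈ W, 0 ≤ f θ) (hfM : ∀ θ ∈ W, f θ ≤ M)
    (hsum : ∀ Z ⊆ W, ∑ θ ∈ Z, f θ ≤ C₁ * Real.sqrt Z.card + C₂) :
    ∑ θ ∈ W, f θ ^ 2 ≤ 4 * C₁ ^ 2 * (harmonic n : ℝ) + 2 * C₂ * M := by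
  classical
  induction n generalizing W with
  | zero =>
    obtain rfl := Finset.card_eq_zero.mp hn
    simp only [Finset.sum_empty, harmonic_zero, Rat.cast_zero]
    positivity
  | succ n ih =>
    have hW := hsum W subset_rfl
    rw [hn] at hW
    rcases le_or_gt (C₁ * √((n + 1 : ℕ) : ℝ)) C₂ with h | h
    · have hH : (0 : ℝ) ≤ (harmonic (n + 1) : ℝ) := by
        exact_mod_cast (harmonic_pos n.succ_ne_zero).le
      calc ∑ θ ∈ W, f θ ^ 2 ≤ ∑ θ ∈ W, M * f θ := Finset.sum_le_sum fun θ hθ => by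
            rw [sq]; exact mul_le_mul_of_nonneg_right (hfM θ hθ) (hf θ hθ)
        _ = M * ∑ θ ∈ W, f θ := (Finset.mul_sum ..).symm
        _ ≤ M * (2 * C₂) := mul_le_mul_of_nonneg_left (by linarith) hM
        _ ≤ _ := by nlinarith [mul_nonneg (sq_nonneg C₁) hH]
    · obtain ⟨θ, hθ, hmin⟩ :=
        W.exists_min_image f (Finset.card_pos.mp (by omega))
      have hcard : ((n + 1 : ℕ) : ℝ) * f θ ≤ ∑ η ∈ W, f η := by
        simpa [hn] using W.card_nsmul_le_sum f (f θ) hmin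
      have hpos : (0 : ℝ) < ((n + 1 : ℕ) : ℝ) := by positivity
      have hsq : f θ ^ 2 ≤ 4 * C₁ ^ 2 * ((n + 1 : ℕ) : ℝ)⁻¹ := by
        rw [← div_eq_mul_inv, le_div_iff₀ hpos]
        have hs := Real.sq_sqrt hpos.le
        have hs0 := Real.sqrt_pos.mpr hpos
        generalize √((n + 1 : ℕ) : ℝ) = s at *
        rw [← hs] at hcard ⊢
        have hle : s * f θ ≤ 2 * C₁ := by
          refine le_of_mul_le_mul_left ?_ hs0
          nlinarith
        have := pow_le_pow_left₀ (mul_nonneg hs0.le (hf θ hθ)) hle 2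
        nlinarith
      have herase := ih (W.erase θ) (by rw [Finset.card_erase_of_mem hθ, hn]; rfl)
        (fun η hη => hf η (Finset.mem_of_mem_erase hη))
        (fun η hη => hfM η (Finset.mem_of_mem_erase hη))
        (fun Z hZ => hsum Z (hZ.trans (W.erase_subset θ)))
      rw [← Finset.add_sum_erase W _ hθ, harmonic_succ]
      push_cast at hsq ⊢
      linarith

/-- Konyagin-type lemma: there is an absolute constant `c > 0` such that if
`∑_{θ∈Z} f(θ) ≤ C₁ √#Z + C₂` for every `Z ⊆ W`, then
`∑_{θ∈W} f(θ)² ≤ c (C₁² log #W + C₂ max_{θ∈W} f(θ))`. -/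
theorem konyagin_second_moment :
    ∃ c : ℝ, 0 < c ∧ ∀ (α : Type) (W : Finset α) (f : α → ℝ)
      (hW : 10 < W.card), (∀ θ ∈ W, 0 ≤ f θ) →
      ∀ C₁ C₂ : ℝ, 0 ≤ C₁ → 0 ≤ C₂ →
        (∀ Z ⊆ W, ∑ θ ∈ Z, f θ ≤ C₁ * Real.sqrt (Z.card) + C₂) →
        ∑ θ ∈ W, (f θ) ^ 2 ≤
          c * (C₁ ^ 2 * Real.log (W.card) +
            C₂ * W.sup' (Finset.card_pos.mp (by omega)) f) := by
  refine ⟨8, by norm_num, fun α W f hW hf C₁ C₂ _ hC₂ hsum => ?_⟩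
  have hne : W.Nonempty := Finset.card_pos.mp (by omega)
  obtain ⟨η, hη⟩ := hne
  have hM : 0 ≤ W.sup' ⟨η, hη⟩ f := (hf η hη).trans (Finset.le_sup' f hη)
  have hmain := sum_sq_le_of_sum_le_sqrt_card hC₂ hM W.card W rfl hf
    (fun θ hθ => Finset.le_sup' f hθ) hsum
  have hH := harmonic_le_one_add_log W.card
  have hlog : 1 ≤ Real.log W.card := by
    rw [Real.le_log_iff_exp_le (by exact_mod_cast (by omega : 0 < W.card))]
    have : (10 : ℝ) < W.card := by exact_mod_cast hW
    linarith [Real.exp_one_lt_d9]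
  have hC := mul_le_mul_of_nonneg_left
    (show (harmonic W.card : ℝ) ≤ 2 * Real.log W.card by linarith) (sq_nonneg C₁)
  nlinarith [mul_nonneg hC₂ hM]
end

section
/- Define S₂(x) = 3·(sin(πx/2)/(πx/2))² for x ≠ 0 and S₂(0) = 3, and set 𝔰(x,y) = S₂(x)·S₂(y). Let H ≥ 1 be a real number and z = (z₁,z₂) ∈ ℝ². Then the absolutely convergent sum ∑_{g=(g₁,g₂)∈ℤ²} 𝔰(g₁/H, g₂/H)·e(g₁z₁ + g₂z₂) satisfies |∑_{g∈ℤ²} 𝔰(g/H)·e(g·z)| ≤ 36·H² · 1[max(‖z₁‖, ‖z₂‖) ≤ 1/(2H)]; in particular the sum equals 0 whenever max(‖z₁‖, ‖z₂‖) > 1/(2H). -/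
/-- `S₂(x) = 3 (sin(πx/2)/(πx/2))²`, with `S₂(0) = 3`. -/
noncomputable def S2f (x : ℝ) : ℝ :=
  if x = 0 then 3 else 3 * (Real.sin (Real.pi * x / 2) / (Real.pi * x / 2)) ^ 2

/-- `‖x‖`: the distance from `x` to the nearest integer. -/
noncomputable def nint (x : ℝ) : ℝ := |x - round x|

lemma hasSum_one_div_sq_mul_exp {w : ℝ} (hw : |w| ≤ 1) :
    HasSum (fun n : ℤ => 1 / (n : ℂ) ^ 2 * Complex.exp (2 * Real.pi * Complex.I * ((n * w : ℝ) : ℂ)))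
      ((2 * Real.pi ^ 2 * (w ^ 2 - |w| + 1 / 6) : ℝ) : ℂ) := by
  obtain ⟨h1, h2⟩ := abs_le.mp hw
  have key : ∀ x ∈ Set.Icc (0 : ℝ) 1, HasSum
      (fun n : ℤ => 1 / (n : ℂ) ^ 2 * Complex.exp (2 * Real.pi * Complex.I * ((n * x : ℝ) : ℂ)))
      ((2 * Real.pi ^ 2 * (x ^ 2 - x + 1 / 6) : ℝ) : ℂ) := by
    intro x hx
    convert hasSum_one_div_pow_mul_fourier_mul_bernoulliFun le_rfl hx using 1
    · ext n
      rw [fourier_coe_apply]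
      congr 2
      push_cast
      ring
    · have hB : bernoulliFun 2 x = x ^ 2 - x + 1 / 6 := by
        simp [bernoulliFun, Polynomial.bernoulli_def, Finset.sum_range_succ, bernoulli,
          bernoulli'_two]
        ring
      rw [hB, mul_pow, mul_pow, Complex.I_sq]
      push_cast [Nat.factorial]
      ring
  rcases le_total 0 w with h | h
  · simpa only [abs_of_nonneg h] using key w ⟨h, h2⟩
  · rw [abs_of_nonpos h]
    convert key (w + 1) ⟨by linarith, by linarith⟩ using 1
    · ext n
      congr 1
      rw [← Complex.exp_periodic.int_mul n]
      congr 1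
      push_cast
      ring
    · push_cast
      ring

lemma S2f_div_mul_exp {H : ℝ} (hH : H ≠ 0) (n : ℤ) (z : ℝ) :
    (S2f (n / H) : ℂ) * Complex.exp (2 * Real.pi * Complex.I * ((n * z : ℝ) : ℂ)) =
      (if n = 0 then 3 else 0) + 3 * H ^ 2 / Real.pi ^ 2 *
        (2 * (1 / (n : ℂ) ^ 2 * Complex.exp (2 * Real.pi * Complex.I * ((n * z : ℝ) : ℂ)))
        - 1 / (n : ℂ) ^ 2 *
          Complex.exp (2 * Real.pi * Complex.I * ((n * (z + 1 / (2 * H)) : ℝ) : ℂ))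
        - 1 / (n : ℂ) ^ 2 *
          Complex.exp (2 * Real.pi * Complex.I * ((n * (z - 1 / (2 * H)) : ℝ) : ℂ))) := by
  rcases eq_or_ne n 0 with rfl | hn
  · simp [S2f]
  have hn' : (n : ℝ) ≠ 0 := by exact_mod_cast hn
  have hnC : (n : ℂ) ≠ 0 := by exact_mod_cast hn
  have hHC : (H : ℂ) ≠ 0 := by exact_mod_cast hH
  have hpi : (Real.pi : ℂ) ≠ 0 := by exact_mod_cast Real.pi_ne_zero
  have hS : S2f (n / H) = 3 * H ^ 2 / Real.pi ^ 2 * (1 / (n : ℝ) ^ 2) *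
      (2 - 2 * Real.cos (Real.pi * n / H)) := by
    have hc : Real.cos (Real.pi * n / H) = 1 - 2 * Real.sin (Real.pi * (n / H) / 2) ^ 2 := by
      rw [← Real.cos_two_mul_eq_one_sub]
      congr 1
      ring
    rw [S2f, if_neg (div_ne_zero hn' hH), hc]
    field_simp
    ring
  have hcos : 2 * (Real.cos (Real.pi * n / H) : ℂ) =
      Complex.exp (Real.pi * n / H * Complex.I) + Complex.exp (-(Real.pi * n / H * Complex.I)) := by
    rw [Complex.ofReal_cos, Complex.two_cos]
    push_cast
    ring_nf
  have hadd : Complex.exp (2 * Real.pi * Complex.I * ((n * (z + 1 / (2 * H)) : ℝ) : ℂ)) =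
      Complex.exp (2 * Real.pi * Complex.I * ((n * z : ℝ) : ℂ)) *
        Complex.exp (Real.pi * n / H * Complex.I) := by
    rw [← Complex.exp_add]
    congr 1
    push_cast
    field_simp
  have hsub : Complex.exp (2 * Real.pi * Complex.I * ((n * (z - 1 / (2 * H)) : ℝ) : ℂ)) =
      Complex.exp (2 * Real.pi * Complex.I * ((n * z : ℝ) : ℂ)) *
        Complex.exp (-(Real.pi * n / H * Complex.I)) := by
    rw [← Complex.exp_add]
    congr 1
    push_cast
    field_simp
    ring
  rw [hS, hadd, hsub, if_neg hn]
  push_cast [-Complex.ofReal_cos]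
  rw [hcos]
  ring

lemma hasSum_S2f_div_mul_exp {H : ℝ} (hH : 1 ≤ H) (z : ℝ) :
    HasSum (fun n : ℤ => (S2f (n / H) : ℂ) *
        Complex.exp (2 * Real.pi * Complex.I * ((n * z : ℝ) : ℂ)))
      ((6 * H * max 0 (1 - 2 * H * nint z) : ℝ) : ℂ) := by
  have hH0 : 0 < H := by linarith
  have ha : 1 / (2 * H) ≤ 1 / 2 := one_div_le_one_div_of_le (by norm_num) (by linarith)
  have ha0 : 0 < 1 / (2 * H) := by positivity
  set w := z - round z with hw
  have hwz : |w| ≤ 1 / 2 := abs_sub_round z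
  obtain ⟨h1, h2⟩ := abs_le.mp hwz
  have hshift : ∀ n : ℤ, Complex.exp (2 * Real.pi * Complex.I * ((n * z : ℝ) : ℂ)) =
      Complex.exp (2 * Real.pi * Complex.I * ((n * w : ℝ) : ℂ)) := by
    intro n
    rw [← Complex.exp_periodic.int_mul (n * round z) (2 * Real.pi * Complex.I * ((n * w : ℝ) : ℂ))]
    congr 1
    rw [hw]
    push_cast
    ring
  simp_rw [hshift, S2f_div_mul_exp hH0.ne']
  convert (hasSum_ite_eq (0 : ℤ) (3 : ℂ)).add (((((hasSum_one_div_sq_mul_exp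
    (w := w) (by linarith)).mul_left 2).sub (hasSum_one_div_sq_mul_exp (w := w + 1 / (2 * H))
      (abs_le.mpr ⟨by linarith, by linarith⟩))).sub (hasSum_one_div_sq_mul_exp
      (w := w - 1 / (2 * H)) (abs_le.mpr ⟨by linarith, by linarith⟩))).mul_left
      (3 * (H : ℂ) ^ 2 / Real.pi ^ 2)) using 1
  norm_cast
  rw [show nint z = |w| from rfl]
  have hval : 3 + 3 * H ^ 2 / Real.pi ^ 2 * (2 * (2 * Real.pi ^ 2 * (w ^ 2 - |w| + 1 / 6)) -
      2 * Real.pi ^ 2 * ((w + 1 / (2 * H)) ^ 2 - |w + 1 / (2 * H)| + 1 / 6) -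
      2 * Real.pi ^ 2 * ((w - 1 / (2 * H)) ^ 2 - |w - 1 / (2 * H)| + 1 / 6)) =
      6 * H ^ 2 * (|w + 1 / (2 * H)| + |w - 1 / (2 * H)| - 2 * |w|) := by
    field_simp
    ring
  have habs : |w + 1 / (2 * H)| + |w - 1 / (2 * H)| - 2 * |w| =
      2 * max 0 (1 / (2 * H) - |w|) := by
    generalize 1 / (2 * H) = a at *
    grind
  have hmax : 2 * H * max 0 (1 / (2 * H) - |w|) = max 0 (1 - 2 * H * |w|) := by
    rw [mul_max_of_nonneg _ _ (by positivity)]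
    congr 1
    · ring
    · field_simp
  rw [hval, habs, ← hmax]
  ring

lemma nint_nonneg (x : ℝ) : 0 ≤ nint x := abs_nonneg _

/-- the sum `∑_{g∈ℤ²} 𝔰(g/H) e(g·z)` converges absolutely and satisfies
`|∑| ≤ 36 H² ⋅ 1[max(‖z₁‖,‖z₂‖) ≤ 1/(2H)]`; in particular it vanishes when
`max(‖z₁‖,‖z₂‖) > 1/(2H)`. -/
theorem smoothed_sum_bound (H : ℝ) (hH : 1 ≤ H) (z₁ z₂ : ℝ) :
    Summable (fun g : ℤ × ℤ =>
      ‖((S2f ((g.1 : ℝ) / H) * S2f ((g.2 : ℝ) / H) : ℝ) : ℂ) *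
        Complex.exp (2 * Real.pi * Complex.I *
          ((((g.1 : ℝ) * z₁ + (g.2 : ℝ) * z₂) : ℝ) : ℂ))‖) ∧
    ‖∑' g : ℤ × ℤ, ((S2f ((g.1 : ℝ) / H) * S2f ((g.2 : ℝ) / H) : ℝ) : ℂ) *
        Complex.exp (2 * Real.pi * Complex.I *
          ((((g.1 : ℝ) * z₁ + (g.2 : ℝ) * z₂) : ℝ) : ℂ))‖ ≤
      36 * H ^ 2 * (if max (nint z₁) (nint z₂) ≤ 1 / (2 * H) then 1 else 0) := by
  have hH0 : 0 < H := by linarith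
  have hprod : ∀ g : ℤ × ℤ, ((S2f ((g.1 : ℝ) / H) * S2f ((g.2 : ℝ) / H) : ℝ) : ℂ) *
        Complex.exp (2 * Real.pi * Complex.I *
          ((((g.1 : ℝ) * z₁ + (g.2 : ℝ) * z₂) : ℝ) : ℂ)) =
      ((S2f (g.1 / H) : ℂ) * Complex.exp (2 * Real.pi * Complex.I * ((g.1 * z₁ : ℝ) : ℂ))) *
      ((S2f (g.2 / H) : ℂ) * Complex.exp (2 * Real.pi * Complex.I * ((g.2 * z₂ : ℝ) : ℂ))) := by
    intro g
    rw [mul_mul_mul_comm, ← Complex.exp_add]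
    push_cast
    ring_nf
  have hs₁ := hasSum_S2f_div_mul_exp hH z₁
  have hs₂ := hasSum_S2f_div_mul_exp hH z₂
  have hn₁ := hs₁.summable.norm
  have hn₂ := hs₂.summable.norm
  have hsummable := hn₁.mul_norm hn₂
  have htsum := tsum_mul_tsum_of_summable_norm hn₁ hn₂
  rw [hs₁.tsum_eq, hs₂.tsum_eq] at htsum
  refine ⟨hsummable.congr fun g => by rw [hprod g], ?_⟩
  rw [tsum_congr hprod]
  rw [← htsum, ← Complex.ofReal_mul, Complex.norm_real, Real.norm_of_nonneg (by positivity)]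
  have hle : ∀ z, max 0 (1 - 2 * H * nint z) ≤ 1 := fun z =>
    max_le zero_le_one (by nlinarith [nint_nonneg z])
  have hzero : ∀ z, 1 / (2 * H) < nint z → max 0 (1 - 2 * H * nint z) = 0 := by
    intro z hz
    rw [div_lt_iff₀ (by positivity)] at hz
    exact max_eq_left (by linarith)
  split_ifs with h
  · calc _ = 36 * H ^ 2 * (max 0 (1 - 2 * H * nint z₁) * max 0 (1 - 2 * H * nint z₂)) := by ring
      _ ≤ 36 * H ^ 2 * 1 := by
        gcongr
        exact mul_le_one₀ (hle z₁) (le_max_left _ _) (hle z₂)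
  · rcases lt_max_iff.mp (not_le.mp h) with h | h <;> simp [hzero _ h]
end

section
/- Let q⁽¹⁾ and q⁽²⁾ be positive integers, and let a⁽¹⁾, a⁽²⁾ be integers with gcd(a⁽¹⁾, q⁽¹⁾) = 1 and gcd(a⁽²⁾, q⁽²⁾) = 1. Let x₁, x₂, y₁, y₂ be integers with gcd(x₁, x₂) = 1 and gcd(y₁, y₂) = 1. If both x₁·a⁽¹⁾/q⁽¹⁾ − y₁·a⁽²⁾/q⁽²⁾ and x₂·a⁽¹⁾/q⁽¹⁾ − y₂·a⁽²⁾/q⁽²⁾ are integers, then q⁽¹⁾ = q⁽²⁾ = gcd(q⁽¹⁾, q⁽²⁾). -/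
/-- If `q` divides `x * (a * r)` and `x' * (a * r)` with `x, x'` coprime and `a, q` coprime,
then `q` divides `r`. -/
theorem dvd_of_dvd_mul_of_isCoprime {q r a x x' : ℤ} (ha : IsCoprime a q)
    (hx : IsCoprime x x') (h : q ∣ x * (a * r)) (h' : q ∣ x' * (a * r)) : q ∣ r := by
  obtain ⟨u, v, huv⟩ := hx
  refine ha.symm.dvd_of_dvd_mul_left ?_
  have key : a * r = u * (x * (a * r)) + v * (x' * (a * r)) := by
    linear_combination -(a * r) * huv
  rw [key]
  exact dvd_add (h.mul_left u) (h'.mul_left v)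

/-- Clearing denominators in `x * a / q - y * b / r = m`. -/
theorem mul_sub_mul_eq_of_div_sub_div_eq {q r : ℕ} (hq : 0 < q) (hr : 0 < r) {a b x y m : ℤ}
    (h : (x : ℚ) * a / q - (y : ℚ) * b / r = m) :
    x * (a * r) - y * (b * q) = m * (q * r) := by
  have hq' : (q : ℚ) ≠ 0 := by positivity
  have hr' : (r : ℚ) ≠ 0 := by positivity
  field_simp at h
  have h' : (x : ℚ) * (a * r) - y * (b * q) = m * (q * r) := by linear_combination h
  exact_mod_cast h'

/-- if `x₁a⁽¹⁾/q⁽¹⁾ − y₁a⁽²⁾/q⁽²⁾` and `x₂a⁽¹⁾/q⁽¹⁾ − y₂a⁽²⁾/q⁽²⁾` are both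
integers, with `(a⁽¹⁾,q⁽¹⁾) = (a⁽²⁾,q⁽²⁾) = (x₁,x₂) = (y₁,y₂) = 1`, then
`q⁽¹⁾ = q⁽²⁾ = (q⁽¹⁾,q⁽²⁾)`. -/
theorem equal_denominators (q₁ q₂ : ℕ) (hq₁ : 0 < q₁) (hq₂ : 0 < q₂)
    (a₁ a₂ x₁ x₂ y₁ y₂ : ℤ)
    (ha₁ : IsCoprime a₁ (q₁ : ℤ)) (ha₂ : IsCoprime a₂ (q₂ : ℤ))
    (hx : IsCoprime x₁ x₂) (hy : IsCoprime y₁ y₂)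
    (h1 : ∃ m : ℤ, (x₁ : ℚ) * a₁ / q₁ - (y₁ : ℚ) * a₂ / q₂ = m)
    (h2 : ∃ m : ℤ, (x₂ : ℚ) * a₁ / q₁ - (y₂ : ℚ) * a₂ / q₂ = m) :
    q₁ = q₂ ∧ q₁ = Nat.gcd q₁ q₂ := by
  obtain ⟨m, hm⟩ := h1
  obtain ⟨n, hn⟩ := h2
  have em := mul_sub_mul_eq_of_div_sub_div_eq hq₁ hq₂ hm
  have en := mul_sub_mul_eq_of_div_sub_div_eq hq₁ hq₂ hn
  have h₁₂ : (q₁ : ℤ) ∣ q₂ := dvd_of_dvd_mul_of_isCoprime ha₁ hx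
    ⟨m * q₂ + y₁ * a₂, by linear_combination em⟩ ⟨n * q₂ + y₂ * a₂, by linear_combination en⟩
  have h₂₁ : (q₂ : ℤ) ∣ q₁ := dvd_of_dvd_mul_of_isCoprime ha₂ hy
    ⟨x₁ * a₁ - m * q₁, by linear_combination -em⟩ ⟨x₂ * a₁ - n * q₁, by linear_combination -en⟩
  have h : q₁ = q₂ := Nat.dvd_antisymm (Int.natCast_dvd_natCast.mp h₁₂)
    (Int.natCast_dvd_natCast.mp h₂₁)
  exact ⟨h, by rw [← h, Nat.gcd_self]⟩
end

section
/- There is an absolute constant C with the following property. Let y₁, y₂ be positive integers with gcd(y₁, y₂) = 1, P a positive integer, and R a real number with y₁ < R/10 and y₂ < R/10. Then ∑_{n=1}^{P} 1[‖y₁·n/P‖ < 1/R] · 1[‖y₂·n/P‖ < 1/R] ≤ 4·(gcd(y₁,P) + gcd(y₂,P))/R + (2P/R)·min(1/y₁, 1/y₂) + 4P/R² + C. -/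
/-- If `n` is simultaneously `P / R`-close to `P`-multiples after multiplication by two small coprime
integers, then `n` itself is close to a multiple of `P`. -/
theorem exists_close_multiple {y₁ y₂ P n : ℕ} {R : ℝ} (h₁ : 0 < y₁) (h₂ : 0 < y₂)
    (hc : Nat.Coprime y₁ y₂) (hP : 0 < P) (hR₁ : (y₁ : ℝ) < R / 10) (hR₂ : (y₂ : ℝ) < R / 10)
    (hn₁ : nint ((y₁ : ℝ) * n / P) < 1 / R) (hn₂ : nint ((y₂ : ℝ) * n / P) < 1 / R) :
    ∃ j : ℤ, |(n : ℝ) - P * j| * y₁ < P / R ∧ |(n : ℝ) - P * j| * y₂ < P / R := by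
  have h₁' : (0 : ℝ) < y₁ := by exact_mod_cast h₁
  have h₂' : (0 : ℝ) < y₂ := by exact_mod_cast h₂
  have hP' : (0 : ℝ) < P := by exact_mod_cast hP
  have hR : 0 < R := by linarith
  unfold nint at hn₁ hn₂
  generalize round ((y₁ : ℝ) * n / P) = a at hn₁
  generalize round ((y₂ : ℝ) * n / P) = b at hn₂
  have hab : (y₂ : ℤ) * a = y₁ * b := by
    have hlt : |(((y₂ : ℤ) * a - y₁ * b : ℤ) : ℝ)| < 1 := by
      have e : (((y₂ : ℤ) * a - y₁ * b : ℤ) : ℝ)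
          = y₁ * ((y₂ : ℝ) * n / P - b) - y₂ * ((y₁ : ℝ) * n / P - a) := by
        push_cast
        ring
      rw [e]
      calc _ ≤ |y₁ * ((y₂ : ℝ) * n / P - b)| + |y₂ * ((y₁ : ℝ) * n / P - a)| := abs_sub _ _
        _ = y₁ * |(y₂ : ℝ) * n / P - b| + y₂ * |(y₁ : ℝ) * n / P - a| := by
          rw [abs_mul, abs_mul, abs_of_pos h₁', abs_of_pos h₂']
        _ ≤ R / 10 * (1 / R) + R / 10 * (1 / R) := by gcongr
        _ < 1 := by
          field_simp
          norm_num
    have := Int.abs_lt_one_iff.mp (by exact_mod_cast hlt : |(y₂ : ℤ) * a - y₁ * b| < 1)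
    linarith
  obtain ⟨j, rfl⟩ : (y₁ : ℤ) ∣ a :=
    (Nat.isCoprime_iff_coprime.mpr hc).dvd_of_dvd_mul_left ⟨b, hab⟩
  obtain rfl : b = y₂ * j := by
    have : (y₁ : ℤ) ≠ 0 := by exact_mod_cast h₁.ne'
    apply mul_left_cancel₀ this
    rw [← hab]
    ring
  have key : ∀ y : ℝ, 0 < y → |y * n / P - y * j| < 1 / R → |(n : ℝ) - P * j| * y < P / R := by
    intro y hy h
    have e : y * n / P - y * j = (n - P * j) * y / P := by field_simp
    rw [e, abs_div, abs_mul, abs_of_pos hy, abs_of_pos hP', div_lt_iff₀ hP'] at h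
    calc _ < _ := h
      _ = P / R := by ring
  push_cast at hn₁ hn₂
  exact ⟨j, key _ h₁' hn₁, key _ h₂' hn₂⟩

/-- generalized Dedekind sums estimate: there is an absolute constant `C` with
`∑_{0<n≤P} 1[‖y₁n/P‖<1/R]·1[‖y₂n/P‖<1/R] ≤ 4((y₁,P)+(y₂,P))/R + (2P/R)min(1/y₁,1/y₂) + 4P/R² + C`
whenever `(y₁,y₂)=1` and `y₁,y₂ < R/10`. -/
theorem dedekind_indicator_sum_bound :
    ∃ C : ℝ, 0 < C ∧ ∀ (y₁ y₂ P : ℕ) (R : ℝ),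
      0 < y₁ → 0 < y₂ → Nat.Coprime y₁ y₂ → 0 < P →
      (y₁ : ℝ) < R / 10 → (y₂ : ℝ) < R / 10 →
      ∑ n ∈ Finset.Icc 1 P,
          (if nint ((y₁ : ℝ) * n / P) < 1 / R then (1 : ℝ) else 0) *
          (if nint ((y₂ : ℝ) * n / P) < 1 / R then (1 : ℝ) else 0) ≤
        4 * ((Nat.gcd y₁ P : ℝ) + (Nat.gcd y₂ P : ℝ)) / R +
          (2 * (P : ℝ) / R) * min (1 / (y₁ : ℝ)) (1 / (y₂ : ℝ)) +
          4 * (P : ℝ) / R ^ 2 + C := by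
  refine ⟨1, one_pos, fun y₁ y₂ P R h₁ h₂ hc hP hR₁ hR₂ ↦ ?_⟩
  have h₁' : (1 : ℝ) ≤ y₁ := by exact_mod_cast h₁
  have h₂' : (1 : ℝ) ≤ y₂ := by exact_mod_cast h₂
  have hP' : (0 : ℝ) < P := by exact_mod_cast hP
  have hR : 10 < R := by linarith
  have hR₀ : 0 < R := by linarith
  set t : ℝ := P / R * min (1 / (y₁ : ℝ)) (1 / (y₂ : ℝ)) with ht
  have ht₀ : 0 ≤ t := by positivity
  have htP : t < P := by
    have : min (1 / (y₁ : ℝ)) (1 / (y₂ : ℝ)) ≤ 1 :=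
      (min_le_left _ _).trans ((div_le_one (by linarith)).mpr h₁')
    calc t ≤ P / R * 1 := by rw [ht]; gcongr
      _ < P := by rw [mul_one]; exact div_lt_self hP' (by linarith)
  have hKP : ⌊t⌋₊ < P := (Nat.floor_lt ht₀).mpr htP
  have hsub : (Finset.Icc 1 P).filter (fun n : ℕ ↦ nint ((y₁ : ℝ) * n / P) < 1 / R ∧
      nint ((y₂ : ℝ) * n / P) < 1 / R) ⊆ Finset.Icc 1 ⌊t⌋₊ ∪ Finset.Icc (P - ⌊t⌋₊) P := by
    intro n hn
    simp only [Finset.mem_filter, Finset.mem_Icc, Finset.mem_union] at hn ⊢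
    obtain ⟨⟨hn1, hnP⟩, hn₁, hn₂⟩ := hn
    obtain ⟨j, hj₁, hj₂⟩ := exists_close_multiple h₁ h₂ hc hP hR₁ hR₂ hn₁ hn₂
    have hjt : |(n : ℝ) - P * j| ≤ t := by
      rw [ht, mul_min_of_nonneg _ _ (by positivity), mul_one_div, mul_one_div]
      exact le_min ((le_div_iff₀ (by linarith)).mpr hj₁.le)
        ((le_div_iff₀ (by linarith)).mpr hj₂.le)
    have hjK : |(n : ℤ) - P * j| ≤ ⌊t⌋₊ := by
      rw [Int.natCast_floor_eq_floor ht₀, Int.le_floor]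
      push_cast
      exact hjt
    rw [abs_le] at hjK
    have hj0 : 0 ≤ j := by
      by_contra! h
      nlinarith
    have hj2 : j ≤ 1 := by
      by_contra! h
      nlinarith
    interval_cases j <;> omega
  have hcard := (Finset.card_le_card hsub).trans (Finset.card_union_le _ _)
  simp only [Nat.card_Icc] at hcard
  replace hcard := hcard.trans (show _ ≤ 2 * ⌊t⌋₊ + 1 by omega)
  have hsum : ∑ n ∈ Finset.Icc 1 P,
      (if nint ((y₁ : ℝ) * n / P) < 1 / R then (1 : ℝ) else 0) *
      (if nint ((y₂ : ℝ) * n / P) < 1 / R then (1 : ℝ) else 0) ≤ 2 * t + 1 := by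
    simp only [ite_zero_mul_ite_zero, mul_one, Finset.sum_boole]
    calc _ ≤ ((2 * ⌊t⌋₊ + 1 : ℕ) : ℝ) := by exact_mod_cast hcard
      _ ≤ 2 * t + 1 := by
        push_cast
        linarith [Nat.floor_le ht₀]
  have hmain : 2 * (P : ℝ) / R * min (1 / (y₁ : ℝ)) (1 / (y₂ : ℝ)) = 2 * t := by
    rw [ht]
    ring
  have hgcd : 0 ≤ 4 * ((Nat.gcd y₁ P : ℝ) + (Nat.gcd y₂ P : ℝ)) / R := by positivity
  have hsq : 0 ≤ 4 * (P : ℝ) / R ^ 2 := by positivity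
  linarith
end
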